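/- Every 2-neighborly 5-polytope with at least 10 vertices has at least 15 facets. -/

import Mathlib

open Set

/-- A polytope is the convex hull of a finite set of points. -/
def IsPolytope {N : ℕ} (P : Set (Fin N → ℝ)) : Prop :=
  ∃ S : Finset (Fin N → ℝ), P = convexHull ℝ (S : Set (Fin N → ℝ))

/-- The dimension of a set: the dimension of its affine span. -/
noncomputable def pdim {N : ℕ} (P : Set (Fin N → ℝ)) : ℕ :=
  Module.finrank ℝ (affineSpan ℝ P).direction

/-- A vertex is a 0-dimensional (exposed) face, i.e. an exposed singleton. -/
def IsVertex {N : ℕ} (P : Set (Fin N → ℝ)) (v : Fin N → ℝ) : Prop :=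
  IsExposed ℝ P {v}

/-- The set of vertices of `P`. -/
def vertexSet {N : ℕ} (P : Set (Fin N → ℝ)) : Set (Fin N → ℝ) :=
  {v | IsVertex P v}

/-- A facet is a nonempty exposed face of dimension one less than the polytope. -/
def IsFacetOf {N : ℕ} (P F : Set (Fin N → ℝ)) : Prop :=
  IsExposed ℝ P F ∧ F.Nonempty ∧ pdim F + 1 = pdim P

/-- The set of facets of `P`. -/
def facetSet {N : ℕ} (P : Set (Fin N → ℝ)) : Set (Set (Fin N → ℝ)) :=
  {F | IsFacetOf P F}

/-- A polytope is 2-neighborly if every pair of distinct vertices is the vertex set of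
an edge (1-dimensional face), i.e. the segment between them is an exposed face. -/
def TwoNeighborly {N : ℕ} (P : Set (Fin N → ℝ)) : Prop :=
  ∀ u v : Fin N → ℝ, IsVertex P u → IsVertex P v → u ≠ v →
    IsExposed ℝ P (convexHull ℝ {u, v}) ∧ pdim (convexHull ℝ ({u, v} : Set (Fin N → ℝ))) = 1

/-- A polytope is 2-simplicial if every 2-dimensional face has exactly 3 vertices. -/
def TwoSimplicial {N : ℕ} (P : Set (Fin N → ℝ)) : Prop :=
  ∀ F : Set (Fin N → ℝ), IsExposed ℝ P F → F.Nonempty → pdim F = 2 →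
    (vertexSet F).ncard = 3

/-- A polytope is a pyramid if some vertex (the apex) is not in the affine span
of the remaining vertices. -/
def IsPyramid {N : ℕ} (P : Set (Fin N → ℝ)) : Prop :=
  ∃ v : Fin N → ℝ, IsVertex P v ∧ v ∉ affineSpan ℝ (vertexSet P \ {v})

/-- `P` is a pyramid over `Q`: `Q` is a facet of `P` and `P` is the convex hull of `Q`
together with one additional point (the apex) not in the affine span of `Q`. -/
def IsPyramidOver {N : ℕ} (P Q : Set (Fin N → ℝ)) : Prop :=
  IsFacetOf P Q ∧ ∃ a : Fin N → ℝ, a ∉ affineSpan ℝ Q ∧ P = convexHull ℝ (Q ∪ {a})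

/-- `P` is a `k`-fold pyramid over `Q`. -/
def IsKFoldPyramidOver {N : ℕ} : ℕ → Set (Fin N → ℝ) → Set (Fin N → ℝ) → Prop
  | 0, P, Q => P = Q
  | k + 1, P, Q => ∃ R : Set (Fin N → ℝ), IsKFoldPyramidOver k R Q ∧ IsPyramidOver P R

/-- A set `S` of indices is a face of the vector configuration `p` if it is the zero set of a
functional that is nonnegative on `p`. -/
def IsFaceSet {ι E : Type*} [AddCommGroup E] [Module ℝ E] (p : ι → E) (S : Finset ι) : Prop :=
  ∃ φ : Module.Dual ℝ E, (∀ i, 0 ≤ φ (p i)) ∧ ∀ i, φ (p i) = 0 ↔ i ∈ S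

/-- A facet of a vector configuration is a face spanning a hyperplane. -/
def IsFacetSet {ι E : Type*} [AddCommGroup E] [Module ℝ E] (p : ι → E) (S : Finset ι) : Prop :=
  IsFaceSet p S ∧
    Module.finrank ℝ (Submodule.span ℝ (p '' (S : Set ι))) + 1 = Module.finrank ℝ E

open Classical in
/-- The facets of a vector configuration. -/
noncomputable def configFacets {ι E : Type*} [Fintype ι] [AddCommGroup E] [Module ℝ E]
    (p : ι → E) : Finset (Finset ι) :=
  Finset.univ.filter (IsFacetSet p)

section Configuration

variable {ι E : Type*} [Fintype ι] [AddCommGroup E] [Module ℝ E]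

lemma mem_configFacets {p : ι → E} {F : Finset ι} : F ∈ configFacets p ↔ IsFacetSet p F := by
  simp [configFacets]

lemma exists_large_multiple_add_pos (a b : ι → ℝ) :
    ∃ M : ℝ, ∀ i, 0 < a i → 0 < M * a i + b i := by
  have h : ∀ᶠ M : ℝ in Filter.atTop, ∀ i, 0 < a i → 0 < M * a i + b i := by
    rw [Filter.eventually_all]
    intro i
    by_cases hi : 0 < a i
    · have := (Filter.tendsto_id.atTop_mul_const hi).atTop_add
        (tendsto_const_nhds (x := b i))
      filter_upwards [this.eventually_gt_atTop 0] with M hM _ using hM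
    · exact Filter.Eventually.of_forall fun M h => absurd h hi
  exact h.exists

/-- A face of a face is a face. -/
lemma IsFaceSet.of_face {p : ι → E} {Z S : Finset ι} (hZ : IsFaceSet p Z) (hSZ : S ⊆ Z)
    (χ : Module.Dual ℝ E) (h0 : ∀ i ∈ S, χ (p i) = 0) (hpos : ∀ i ∈ Z, i ∉ S → 0 < χ (p i)) :
    IsFaceSet p S := by
  obtain ⟨φ, hφ, hφZ⟩ := hZ
  obtain ⟨M, hM⟩ := exists_large_multiple_add_pos (fun i => φ (p i)) (fun i => χ (p i))
  have key : ∀ i, i ∉ S → 0 < (M • φ + χ) (p i) := by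
    intro i hi
    by_cases hiZ : i ∈ Z
    · simpa [(hφZ i).2 hiZ] using hpos i hiZ hi
    · have : 0 < φ (p i) := lt_of_le_of_ne (hφ i) fun h => hiZ ((hφZ i).1 h.symm)
      simpa using hM i this
  have key0 : ∀ i ∈ S, (M • φ + χ) (p i) = 0 := by
    intro i hi
    simp [(hφZ i).2 (hSZ hi), h0 i hi]
  refine ⟨M • φ + χ, fun i => ?_, fun i => ⟨fun h => ?_, key0 i⟩⟩
  · by_cases hi : i ∈ S
    · exact (key0 i hi).ge
    · exact (key i hi).le
  · by_contra hi
    exact (key i hi).ne' h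

/-- Rotating a supporting hyperplane about its zero set until it meets a further vector. -/
lemma exists_rotation {p : ι → E} {φ ψ : Module.Dual ℝ E} (hφ : ∀ i, 0 ≤ φ (p i))
    {j : ι} (hj : ψ (p j) < 0) :
    ∃ t : ℝ, (∀ i, 0 ≤ (φ + t • ψ) (p i)) ∧ ∃ i, ψ (p i) < 0 ∧ (φ + t • ψ) (p i) = 0 := by
  classical
  obtain ⟨i₀, hi₀, hmin⟩ := Finset.exists_min_image
    (Finset.univ.filter fun i => ψ (p i) < 0) (fun i => φ (p i) / -ψ (p i)) ⟨j, by simpa using hj⟩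
  replace hi₀ : ψ (p i₀) < 0 := by simpa using hi₀
  refine ⟨φ (p i₀) / -ψ (p i₀), fun i => ?_, i₀, hi₀, ?_⟩
  · have ht : 0 ≤ φ (p i₀) / -ψ (p i₀) := div_nonneg (hφ _) (by linarith)
    simp only [LinearMap.add_apply, LinearMap.smul_apply, smul_eq_mul]
    by_cases hi : ψ (p i) < 0
    · have := hmin i (by simpa using hi)
      rw [le_div_iff₀ (by linarith)] at this
      linarith
    · have := hφ i
      have := mul_nonneg ht (not_lt.1 hi)
      linarith
  · simp only [LinearMap.add_apply, LinearMap.smul_apply, smul_eq_mul, div_neg, neg_mul]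
    rw [div_mul_cancel₀ _ hi₀.ne, add_neg_cancel]

/-- Every vector outside the span of a face is off some facet hyperplane through that face. -/
lemma IsFaceSet.exists_facet [FiniteDimensional ℝ E] {p : ι → E} (hspan : Submodule.span ℝ (Set.range p) = ⊤)
    {Z : Finset ι} (hZ : IsFaceSet p Z) {x : E}
    (hx : x ∉ Submodule.span ℝ (p '' (Z : Set ι))) :
    ∃ F : Finset ι, Z ⊆ F ∧ IsFacetSet p F ∧ ∃ φ : Module.Dual ℝ E,
      (∀ i, 0 ≤ φ (p i)) ∧ (∀ i, φ (p i) = 0 ↔ i ∈ F) ∧ φ x ≠ 0 := by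
  classical
  let 𝒮 : Finset (Finset ι) := Finset.univ.filter fun F => Z ⊆ F ∧ ∃ φ : Module.Dual ℝ E,
      (∀ i, 0 ≤ φ (p i)) ∧ (∀ i, φ (p i) = 0 ↔ i ∈ F) ∧ φ x ≠ 0
  have hne : 𝒮.Nonempty := by
    obtain ⟨φ, hφ, hφZ⟩ := hZ
    by_cases hφx : φ x = 0
    · obtain ⟨ψ, hψx, hψ⟩ := Submodule.exists_le_ker_of_notMem hx
      have hψZ : ∀ i ∈ Z, ψ (p i) = 0 := fun i hi =>
        hψ (Submodule.subset_span ⟨i, hi, rfl⟩)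
      obtain ⟨M, hM⟩ := exists_large_multiple_add_pos (fun i => φ (p i)) (fun i => ψ (p i))
      have key : ∀ i, i ∉ Z → 0 < (M • φ + ψ) (p i) := by
        intro i hi
        have : 0 < φ (p i) := lt_of_le_of_ne (hφ i) fun h => hi ((hφZ i).1 h.symm)
        simpa using hM i this
      have key0 : ∀ i ∈ Z, (M • φ + ψ) (p i) = 0 := by
        intro i hi
        simp [(hφZ i).2 hi, hψZ i hi]
      refine ⟨Z, by
        simp only [𝒮, Finset.mem_filter, Finset.mem_univ, true_and]
        refine ⟨subset_rfl, M • φ + ψ, fun i => ?_, fun i => ⟨fun h => ?_, key0 i⟩, ?_⟩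
        · by_cases hi : i ∈ Z
          · exact (key0 i hi).ge
          · exact (key i hi).le
        · by_contra hi
          exact (key i hi).ne' h
        · simpa [hφx] using hψx⟩
    · exact ⟨Z, by simpa [𝒮] using ⟨φ, hφ, hφZ, hφx⟩⟩
  obtain ⟨F, hF, hmax⟩ := Finset.exists_max_image 𝒮 Finset.card hne
  simp only [𝒮, Finset.mem_filter, Finset.mem_univ, true_and] at hF hmax
  obtain ⟨hZF, φ, hφ, hφF, hφx⟩ := hF
  refine ⟨F, hZF, ⟨⟨φ, hφ, hφF⟩, ?_⟩, φ, hφ, hφF, hφx⟩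
  have hle : Submodule.span ℝ (p '' (F : Set ι)) ≤ LinearMap.ker φ := by
    rw [Submodule.span_le]
    rintro _ ⟨i, hi, rfl⟩
    exact (hφF i).2 hi
  have hlt : Module.finrank ℝ (Submodule.span ℝ (p '' (F : Set ι))) < Module.finrank ℝ E := by
    apply Submodule.finrank_lt
    intro h
    exact hφx (hle (h ▸ Submodule.mem_top))
  by_contra hcon
  set W := Submodule.span ℝ (p '' (F : Set ι)) ⊔ Submodule.span ℝ {x} with hW
  have hWlt : W < ⊤ := by
    rw [lt_top_iff_ne_top]
    intro h
    have h1 := Submodule.finrank_add_le_finrank_add_finrank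
      (Submodule.span ℝ (p '' (F : Set ι))) (Submodule.span ℝ {x})
    have h2 : Module.finrank ℝ (Submodule.span ℝ {x}) ≤ 1 := by
      simpa using finrank_span_le_card (R := ℝ) ({x} : Set E)
    rw [← hW, h, finrank_top] at h1
    omega
  obtain ⟨ψ₀, hψ₀, hWψ₀⟩ := Submodule.exists_le_ker_of_lt_top W hWlt
  obtain ⟨ψ, hWψ, j, hj⟩ : ∃ ψ : Module.Dual ℝ E, W ≤ LinearMap.ker ψ ∧ ∃ j, ψ (p j) < 0 := by
    obtain ⟨j, hj⟩ : ∃ j, ψ₀ (p j) ≠ 0 := by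
      by_contra! h
      apply hψ₀
      apply LinearMap.ext_on_range hspan
      simpa using h
    rcases lt_or_gt_of_ne hj with hj | hj
    · exact ⟨ψ₀, hWψ₀, j, hj⟩
    · refine ⟨-ψ₀, fun w hw => ?_, j, by simpa using hj⟩
      simpa using hWψ₀ hw
  have hψx : ψ x = 0 :=
    hWψ (Submodule.mem_sup_right (Submodule.mem_span_singleton_self x))
  have hψF : ∀ i ∈ F, ψ (p i) = 0 := fun i hi =>
    hWψ (Submodule.mem_sup_left (Submodule.subset_span ⟨i, hi, rfl⟩))
  obtain ⟨t, ht, i₀, hi₀, hti₀⟩ := exists_rotation hφ hj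
  have hFF : insert i₀ F ⊆ Finset.univ.filter fun i => (φ + t • ψ) (p i) = 0 := by
    intro i hi
    rcases Finset.mem_insert.1 hi with rfl | hi
    · simpa using hti₀
    · simp [(hφF i).2 hi, hψF i hi]
  have hi₀F : i₀ ∉ F := fun h => hi₀.ne (hψF i₀ h)
  have := hmax (Finset.univ.filter fun i => (φ + t • ψ) (p i) = 0)
    ⟨hZF.trans ((Finset.subset_insert _ _).trans hFF), φ + t • ψ, ht, by simp, by simpa [hψx]⟩
  have h2 := Finset.card_le_card hFF
  rw [Finset.card_insert_of_notMem hi₀F] at h2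
  omega

omit [Fintype ι] in
/-- The kernel of a functional cutting out a facet is the span of the facet. -/
lemma IsFacetSet.ker_eq [FiniteDimensional ℝ E] {p : ι → E} (hspan : Submodule.span ℝ (Set.range p) = ⊤)
    {F : Finset ι} (hF : IsFacetSet p F) {φ : Module.Dual ℝ E}
    (hφF : ∀ i, φ (p i) = 0 ↔ i ∈ F) :
    LinearMap.ker φ = Submodule.span ℝ (p '' (F : Set ι)) := by
  have hle : Submodule.span ℝ (p '' (F : Set ι)) ≤ LinearMap.ker φ := by
    rw [Submodule.span_le]
    rintro _ ⟨i, hi, rfl⟩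
    exact (hφF i).2 hi
  have hne : LinearMap.ker φ ≠ ⊤ := by
    intro h
    have hu : (F : Set ι) = Set.univ := by
      ext i
      simp only [SetLike.mem_coe, Set.mem_univ, iff_true]
      exact (hφF i).1 (h ▸ Submodule.mem_top : p i ∈ LinearMap.ker φ)
    have := hF.2
    rw [hu, Set.image_univ, hspan, finrank_top] at this
    omega
  have h1 := Submodule.finrank_mono hle
  have h2 := Submodule.finrank_lt hne
  have h3 := hF.2
  exact (Submodule.eq_of_le_of_finrank_eq hle (by omega)).symm

/-- A face of codimension `k` lies in at least `k` facets. -/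
lemma IsFaceSet.finrank_le_card_facets {p : ι → E}
    (hspan : Submodule.span ℝ (Set.range p) = ⊤) {Z : Finset ι} (hZ : IsFaceSet p Z)
    [DecidableEq ι] [FiniteDimensional ℝ E] :
    Module.finrank ℝ E ≤ Module.finrank ℝ (Submodule.span ℝ (p '' (Z : Set ι))) +
      ((configFacets p).filter (Z ⊆ ·)).card := by
  set 𝒢 := (configFacets p).filter (Z ⊆ ·) with h𝒢_def
  have h𝒢 : ∀ F, F ∈ 𝒢 ↔ IsFacetSet p F ∧ Z ⊆ F := by
    simp [h𝒢_def, mem_configFacets]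
  let L : E →ₗ[ℝ] (𝒢 → ℝ) := LinearMap.pi fun F => ((h𝒢 F.1).1 F.2).1.1.choose
  have hL : LinearMap.ker L ≤ Submodule.span ℝ (p '' (Z : Set ι)) := by
    intro x hx
    by_contra hxZ
    obtain ⟨F, hZF, hF, φ, hφ, hφF, hφx⟩ := hZ.exists_facet hspan hxZ
    have hmem : F ∈ 𝒢 := (h𝒢 F).2 ⟨hF, hZF⟩
    set χ := ((h𝒢 F).1 hmem).1.1.choose with hχ
    obtain ⟨hχ0, hχF⟩ := ((h𝒢 F).1 hmem).1.1.choose_spec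
    have hχx : χ x = 0 := congrFun (LinearMap.mem_ker.1 hx) ⟨F, hmem⟩
    have h1 : LinearMap.ker χ = LinearMap.ker φ :=
      (hF.ker_eq hspan hχF).trans (hF.ker_eq hspan hφF).symm
    have h2 : x ∈ LinearMap.ker χ := hχx
    rw [h1] at h2
    exact hφx h2
  have h1 := LinearMap.finrank_range_add_finrank_ker L
  have h2 := Submodule.finrank_mono hL
  have h3 := Submodule.finrank_le (LinearMap.range L)
  rw [Module.finrank_fintype_fun_eq_card, Fintype.card_coe] at h3
  omega

/-- A vector configuration is 2-neighborly if every set of at most two indices is a face. -/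
def IsNeighborlyConfig (p : ι → E) : Prop :=
  ∀ S : Finset ι, S.card ≤ 2 → IsFaceSet p S

lemma IsNeighborlyConfig.three_le_card_pos {p : ι → E} (hp : IsNeighborlyConfig p) {c : ι → ℝ}
    (hc : ∑ i, c i • p i = 0) (hne : ∃ i, c i ≠ 0) :
    3 ≤ (Finset.univ.filter fun i => 0 < c i).card := by
  by_contra! hlt
  set A := Finset.univ.filter fun i => 0 < c i with hA
  obtain ⟨φ, hφ, hφA⟩ := hp A (by omega)
  have hsum : ∑ i, c i * φ (p i) = 0 := by
    simpa using congrArg φ hc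
  have hterm : ∀ i, c i * φ (p i) ≤ 0 := by
    intro i
    by_cases hi : 0 < c i
    · rw [(hφA i).2 (by simpa [hA] using hi), mul_zero]
    · exact mul_nonpos_of_nonpos_of_nonneg (not_lt.1 hi) (hφ i)
  have hzero := (Finset.sum_eq_zero_iff_of_nonpos fun i _ => hterm i).1 hsum
  have hnonneg : ∀ i, 0 ≤ c i := by
    intro i
    by_contra! hi
    rcases mul_eq_zero.1 (hzero i (Finset.mem_univ i)) with h | h
    · exact hi.ne h
    · have := (hφA i).1 h
      simp only [hA, Finset.mem_filter, Finset.mem_univ, true_and] at this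
      linarith
  obtain ⟨φ', hφ', hφ'e⟩ := hp ∅ (by simp)
  have hsum' : ∑ i, c i * φ' (p i) = 0 := by
    simpa using congrArg φ' hc
  obtain ⟨i, hi⟩ := hne
  rcases mul_eq_zero.1 ((Finset.sum_eq_zero_iff_of_nonneg
    fun i _ => mul_nonneg (hnonneg i) (hφ' i)).1 hsum' i (Finset.mem_univ i)) with h | h
  · exact hi h
  · simpa using (hφ'e i).1 h

lemma IsNeighborlyConfig.three_le_card_neg {p : ι → E} (hp : IsNeighborlyConfig p) {c : ι → ℝ}
    (hc : ∑ i, c i • p i = 0) (hne : ∃ i, c i ≠ 0) :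
    3 ≤ (Finset.univ.filter fun i => c i < 0).card := by
  have := hp.three_le_card_pos (c := fun i => -c i) (by simpa using hc) (by simpa using hne)
  simpa using this

lemma IsNeighborlyConfig.linearIndepOn {p : ι → E} (hp : IsNeighborlyConfig p) {S : Finset ι}
    (hS : S.card ≤ 5) : LinearIndepOn ℝ p (S : Set ι) := by
  classical
  rw [linearIndepOn_finset_iff]
  intro f hf
  by_contra! hne
  obtain ⟨i, hi, hfi⟩ := hne
  let c : ι → ℝ := fun i => if i ∈ S then f i else 0
  have hc : ∑ i, c i • p i = 0 := by
    rw [← hf]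
    simp [c, ite_smul, Finset.sum_ite_mem]
  have hcne : ∃ i, c i ≠ 0 := ⟨i, by simpa [c, hi] using hfi⟩
  have h1 := hp.three_le_card_pos hc hcne
  have h2 := hp.three_le_card_neg hc hcne
  have h3 : Disjoint (Finset.univ.filter fun i => 0 < c i)
      (Finset.univ.filter fun i => c i < 0) := by
    rw [Finset.disjoint_filter]
    intro i _ h h'
    linarith
  have h4 : (Finset.univ.filter fun i => 0 < c i) ∪
      (Finset.univ.filter fun i => c i < 0) ⊆ S := by
    intro i hi
    by_contra hiS
    simp [c, hiS] at hi
  have h5 := Finset.card_le_card h4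
  rw [Finset.card_union_of_disjoint h3] at h5
  omega

omit [Fintype ι] in
lemma finrank_span_image_of_linearIndepOn {p : ι → E} {S : Finset ι}
    (hS : LinearIndepOn ℝ p (S : Set ι)) :
    Module.finrank ℝ (Submodule.span ℝ (p '' (S : Set ι))) = S.card := by
  have := finrank_span_eq_card hS
  rw [← Set.image_eq_range] at this
  simpa using this

omit [Fintype ι] in
lemma exists_dual_apply_eq_of_linearIndepOn {p : ι → E} {S : Finset ι}
    (hS : LinearIndepOn ℝ p (S : Set ι)) (a : ι → ℝ) :
    ∃ χ : Module.Dual ℝ E, ∀ i ∈ S, χ (p i) = a i := by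
  let b := Module.Basis.span hS
  obtain ⟨χ, hχ⟩ := LinearMap.exists_extend (b.constr ℝ fun i : (S : Set ι) => a i)
  refine ⟨χ, fun i hi => ?_⟩
  have h1 : (b ⟨i, hi⟩ : E) = p i :=
    congrArg Subtype.val (Module.Basis.span_apply hS ⟨i, hi⟩)
  rw [← h1]
  exact (LinearMap.congr_fun hχ (b ⟨i, hi⟩)).trans (b.constr_basis ℝ _ _)

/-- Two facets of a 2-neighborly configuration sharing enough indices to span a hyperplane
coincide. -/
lemma IsNeighborlyConfig.facet_unique [FiniteDimensional ℝ E] {p : ι → E} (hp : IsNeighborlyConfig p)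
    (hspan : Submodule.span ℝ (Set.range p) = ⊤) {F G S : Finset ι}
    (hF : IsFacetSet p F) (hG : IsFacetSet p G) (hSF : S ⊆ F) (hSG : S ⊆ G) (hS5 : S.card ≤ 5)
    (hS : S.card + 1 = Module.finrank ℝ E) : F = G := by
  have key : ∀ H, IsFacetSet p H → S ⊆ H →
      Submodule.span ℝ (p '' (S : Set ι)) = Submodule.span ℝ (p '' (H : Set ι)) := by
    intro H hH hSH
    apply Submodule.eq_of_le_of_finrank_eq
      (Submodule.span_mono (Set.image_mono (by simpa using hSH)))
    rw [finrank_span_image_of_linearIndepOn (hp.linearIndepOn hS5)]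
    have := hH.2
    omega
  have hspanFG := (key F hF hSF).symm.trans (key G hG hSG)
  have hmem : ∀ H, IsFacetSet p H → ∀ i, i ∈ H ↔ p i ∈ Submodule.span ℝ (p '' (H : Set ι)) := by
    intro H hH i
    obtain ⟨φ, _, hφH⟩ := hH.1
    rw [← hH.ker_eq hspan hφH, LinearMap.mem_ker, hφH]
  ext i
  rw [hmem F hF, hmem G hG, hspanFG]

variable [FiniteDimensional ℝ E] [DecidableEq ι]

/-- If a functional vanishes on a triangle of a 2-neighborly configuration of rank six, then at
most two facets through the triangle contain vectors on both sides of its kernel. -/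
lemma IsNeighborlyConfig.card_mixed_facets_le {p : ι → E} (hp : IsNeighborlyConfig p)
    (hspan : Submodule.span ℝ (Set.range p) = ⊤) (hE : Module.finrank ℝ E = 6)
    {T : Finset ι} (hT : T.card = 3) {γ : Module.Dual ℝ E} (hγT : ∀ i ∈ T, γ (p i) = 0) :
    (((configFacets p).filter (T ⊆ ·)).filter fun F =>
      (∃ a ∈ F, 0 < γ (p a)) ∧ ∃ b ∈ F, γ (p b) < 0).card ≤ 2 := by
  by_contra! hlt
  obtain ⟨F₀, h₀, F₁, h₁, F₂, h₂, h₀₁, h₀₂, h₁₂⟩ := Finset.two_lt_card.1 hlt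
  simp only [Finset.mem_filter, mem_configFacets] at h₀ h₁ h₂
  have hγ0 : γ ≠ 0 := by
    rintro rfl
    obtain ⟨-, ⟨a, -, ha⟩, -⟩ := h₀
    simp at ha
  have crossing : ∀ F : Finset ι, ((IsFacetSet p F ∧ T ⊆ F) ∧
      (∃ a ∈ F, 0 < γ (p a)) ∧ ∃ b ∈ F, γ (p b) < 0) →
      ∃ x : E, γ x = 0 ∧ (∀ φ : Module.Dual ℝ E, (∀ i, φ (p i) = 0 ↔ i ∈ F) → φ x = 0) ∧
      ∀ G : Finset ι, G ≠ F → IsFacetSet p G → T ⊆ G → ∀ φ : Module.Dual ℝ E,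
        (∀ i, 0 ≤ φ (p i)) → (∀ i, φ (p i) = 0 ↔ i ∈ G) → 0 < φ x := by
    rintro F ⟨⟨hF, hTF⟩, ⟨a, haF, ha⟩, b, hbF, hb⟩
    refine ⟨-γ (p b) • p a + γ (p a) • p b, ?_, fun φ hφF => ?_, fun G hGF hG hTG φ hφ hφG => ?_⟩
    · simp only [map_add, map_smul, smul_eq_mul]
      ring
    · simp [(hφF a).2 haF, (hφF b).2 hbF]
    · simp only [map_add, map_smul, smul_eq_mul]
      have h1 := mul_nonneg (neg_pos.2 hb).le (hφ a)
      have h2 := mul_nonneg ha.le (hφ b)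
      refine lt_of_le_of_ne (add_nonneg h1 h2) fun h0 => hGF ?_
      have haG : a ∈ G := by
        rw [← hφG]
        rcases mul_eq_zero.1 (by linarith : -γ (p b) * φ (p a) = 0) with h | h
        · linarith
        · exact h
      have hbG : b ∈ G := by
        rw [← hφG]
        rcases mul_eq_zero.1 (by linarith : γ (p a) * φ (p b) = 0) with h | h
        · linarith
        · exact h
      have haT : a ∉ insert b T := by
        intro h
        rcases Finset.mem_insert.1 h with rfl | h
        · linarith
        · exact ha.ne' (hγT a h)
      have hbT : b ∉ T := fun h => hb.ne (hγT b h)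
      have hcard : (insert a (insert b T)).card = 5 := by
        rw [Finset.card_insert_of_notMem haT, Finset.card_insert_of_notMem hbT, hT]
      exact hp.facet_unique hspan hG hF (S := insert a (insert b T))
        (by simp [Finset.insert_subset_iff, *]) (by simp [Finset.insert_subset_iff, *])
        hcard.le (by omega)
  obtain ⟨x₀, hγ₀, hx₀, hpos₀⟩ := crossing F₀ h₀
  obtain ⟨x₁, hγ₁, hx₁, hpos₁⟩ := crossing F₁ h₁
  obtain ⟨x₂, hγ₂, hx₂, hpos₂⟩ := crossing F₂ h₂
  obtain ⟨φ₀, hφ₀, hφF₀⟩ := h₀.1.1.1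
  obtain ⟨φ₁, hφ₁, hφF₁⟩ := h₁.1.1.1
  obtain ⟨φ₂, hφ₂, hφF₂⟩ := h₂.1.1.1
  obtain ⟨c₀, c₁, c₂, hc, hrel⟩ : ∃ c₀ c₁ c₂ : ℝ, ¬ (c₀ = 0 ∧ c₁ = 0 ∧ c₂ = 0) ∧
      ∀ φ : Module.Dual ℝ E, (∀ i ∈ T, φ (p i) = 0) →
        c₀ * φ x₀ + c₁ * φ x₁ + c₂ * φ x₂ = 0 := by
    let v : T ⊕ Fin 3 → LinearMap.ker γ := Sum.elim (fun i => ⟨p i, hγT i i.2⟩)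
      ![⟨x₀, hγ₀⟩, ⟨x₁, hγ₁⟩, ⟨x₂, hγ₂⟩]
    have hdep : ¬ LinearIndependent ℝ v := by
      intro hv
      have h1 := hv.fintype_card_le_finrank
      have h2 : Module.finrank ℝ (LinearMap.ker γ) < Module.finrank ℝ E := by
        apply Submodule.finrank_lt
        rwa [Ne, LinearMap.ker_eq_top]
      simp [hT] at h1
      omega
    obtain ⟨c, hc, hne⟩ := Fintype.not_linearIndependent_iff.1 hdep
    have hc' : ∑ i : T, c (Sum.inl i) • p i +
        (c (Sum.inr 0) • x₀ + c (Sum.inr 1) • x₁ + c (Sum.inr 2) • x₂) = 0 := by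
      have := congrArg Subtype.val hc
      simpa [v, Fin.sum_univ_three, -Finset.univ_eq_attach] using this
    refine ⟨c (Sum.inr 0), c (Sum.inr 1), c (Sum.inr 2), ?_, fun φ hφ => ?_⟩
    · rintro ⟨hc0, hc1, hc2⟩
      rw [hc0, hc1, hc2] at hc'
      have hind := hp.linearIndepOn (S := T) (by omega)
      have := Fintype.linearIndependent_iff.1 hind (fun i => c (Sum.inl i))
        (by simpa using hc')
      obtain ⟨i | i, hi⟩ := hne
      · exact hi (this i)
      · fin_cases i
        exacts [hi hc0, hi hc1, hi hc2]
    · have := congrArg φ hc'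
      simp only [map_add, map_sum, map_smul, smul_eq_mul, map_zero] at this
      rw [Finset.sum_eq_zero fun i _ => by rw [hφ i i.2, mul_zero], zero_add] at this
      exact this
  have e₀ := hrel φ₀ fun i hi => (hφF₀ i).2 (h₀.1.2 hi)
  have e₁ := hrel φ₁ fun i hi => (hφF₁ i).2 (h₁.1.2 hi)
  have e₂ := hrel φ₂ fun i hi => (hφF₂ i).2 (h₂.1.2 hi)
  rw [hx₀ φ₀ hφF₀] at e₀
  rw [hx₁ φ₁ hφF₁] at e₁
  rw [hx₂ φ₂ hφF₂] at e₂
  have m₀₁ := hpos₁ F₀ h₀₁ h₀.1.1 h₀.1.2 φ₀ hφ₀ hφF₀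
  have m₀₂ := hpos₂ F₀ h₀₂ h₀.1.1 h₀.1.2 φ₀ hφ₀ hφF₀
  have m₁₀ := hpos₀ F₁ h₀₁.symm h₁.1.1 h₁.1.2 φ₁ hφ₁ hφF₁
  have m₁₂ := hpos₂ F₁ h₁₂ h₁.1.1 h₁.1.2 φ₁ hφ₁ hφF₁
  have m₂₀ := hpos₀ F₂ h₀₂.symm h₂.1.1 h₂.1.2 φ₂ hφ₂ hφF₂
  have m₂₁ := hpos₁ F₂ h₁₂.symm h₂.1.1 h₂.1.2 φ₂ hφ₂ hφF₂
  have opposite : ∀ {a b x y : ℝ}, 0 < x → 0 < y → a * x + b * y = 0 →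
      (0 < a → b < 0) ∧ (a < 0 → 0 < b) ∧ (a = 0 → b = 0) := by
    intro a b x y hx hy hab
    refine ⟨fun ha => ?_, fun ha => ?_, fun ha => ?_⟩
    · by_contra! hb
      nlinarith [mul_pos ha hx, mul_nonneg hb hy.le]
    · by_contra! hb
      nlinarith [mul_pos (neg_pos.2 ha) hx, mul_nonneg (neg_nonneg.2 hb) hy.le]
    · subst ha
      have : b * y = 0 := by linarith
      exact (mul_eq_zero.1 this).resolve_right hy.ne'
  have o₁₂ := opposite m₀₁ m₀₂ (by linarith : c₁ * φ₀ x₁ + c₂ * φ₀ x₂ = 0)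
  have o₀₂ := opposite m₁₀ m₁₂ (by linarith : c₀ * φ₁ x₀ + c₂ * φ₁ x₂ = 0)
  have o₀₁ := opposite m₂₀ m₂₁ (by linarith : c₀ * φ₂ x₀ + c₁ * φ₂ x₁ = 0)
  rcases lt_trichotomy c₀ 0 with h | h | h
  · have := o₁₂.1 (o₀₁.2.1 h)
    have := o₀₂.2.1 h
    linarith
  · exact hc ⟨h, o₀₁.2.2 h, o₀₂.2.2 h⟩
  · have := o₁₂.2.1 (o₀₁.1 h)
    have := o₀₂.1 h
    linarith

open Classical in
/-- The indices completing the set `e` to a face by one element. -/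
noncomputable def linkVertices (p : ι → E) (e : Finset ι) : Finset ι :=
  Finset.univ.filter fun w => w ∉ e ∧ IsFaceSet p (insert w e)

omit [FiniteDimensional ℝ E] in
lemma mem_linkVertices {p : ι → E} {e : Finset ι} {w : ι} :
    w ∈ linkVertices p e ↔ w ∉ e ∧ IsFaceSet p (insert w e) := by
  simp [linkVertices]

omit [FiniteDimensional ℝ E] in
/-- A pencil of hyperplanes through an edge, separating all vectors off the edge. -/
lemma IsNeighborlyConfig.exists_pencil {p : ι → E} (hp : IsNeighborlyConfig p)
    {e : Finset ι} (he : e.card = 2) :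
    ∃ h g : Module.Dual ℝ E, (∀ i, 0 ≤ h (p i)) ∧ (∀ i, h (p i) = 0 ↔ i ∈ e) ∧
      (∀ i ∈ e, g (p i) = 0) ∧
      ∀ v w, v ∉ e → w ∉ e → g (p v) / h (p v) = g (p w) / h (p w) → v = w := by
  obtain ⟨h, hh, hhe⟩ := hp e he.le
  set W := Submodule.span ℝ (p '' (e : Set ι)) with hW
  let κ := {vw : ι × ι // vw.1 ∉ e ∧ vw.2 ∉ e ∧ vw.1 ≠ vw.2}
  let x : κ → E := fun k => h (p k.1.2) • p k.1.1 - h (p k.1.1) • p k.1.2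
  have hx : ∀ k, W.mkQ (x k) ≠ 0 := by
    rintro ⟨⟨v, w⟩, hv, hw, hvw⟩ h0
    simp only at hv hw hvw
    rw [Submodule.mkQ_apply, Submodule.Quotient.mk_eq_zero] at h0
    have hvT : v ∉ insert w e := by simp [hv, hvw]
    have hind := hp.linearIndepOn (S := insert v (insert w e)) (by
      rw [Finset.card_insert_of_notMem hvT, Finset.card_insert_of_notMem hw, he]
      norm_num)
    obtain ⟨χ, hχ⟩ := exists_dual_apply_eq_of_linearIndepOn hind
      (fun i => if i = v then 1 else 0)
    have hWχ : W ≤ LinearMap.ker χ := by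
      rw [hW, Submodule.span_le]
      rintro _ ⟨i, hi, rfl⟩
      have hi' : i ∈ e := hi
      have : i ≠ v := by rintro rfl; exact hv hi
      simpa [this] using hχ i (by simp [hi'])
    have h1 : χ (x ⟨⟨v, w⟩, hv, hw, hvw⟩) = 0 := hWχ h0
    have hχv : χ (p v) = 1 := by simpa using hχ v (by simp)
    have hχw : χ (p w) = 0 := by simpa [hvw.symm] using hχ w (by simp)
    simp only [x, map_sub, map_smul, smul_eq_mul, hχv, hχw, mul_one, mul_zero, sub_zero] at h1
    exact hw ((hhe w).1 h1)
  obtain ⟨f, hf⟩ := Module.exists_dual_forall_apply_ne_zero (K := ℝ) (fun k => W.mkQ (x k)) hx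
  refine ⟨h, f ∘ₗ W.mkQ, hh, hhe, fun i hi => ?_, fun v w hv hw hvw => ?_⟩
  · have : W.mkQ (p i) = 0 := by
      rw [Submodule.mkQ_apply, Submodule.Quotient.mk_eq_zero]
      exact Submodule.subset_span ⟨i, hi, rfl⟩
    simp [this]
  · by_contra hne
    apply hf ⟨⟨v, w⟩, hv, hw, hne⟩
    have hv0 : h (p v) ≠ 0 := fun h => hv ((hhe v).1 h)
    have hw0 : h (p w) ≠ 0 := fun h => hw ((hhe w).1 h)
    rw [div_eq_div_iff hv0 hw0] at hvw
    simp only [LinearMap.comp_apply] at hvw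
    simp only [x, map_sub, map_smul, smul_eq_mul]
    linarith

/-- The key inequality for the link of an edge: a sweep bounds the number of incidences between
triangles and facets through the edge by the number of facets. -/
lemma IsNeighborlyConfig.sum_card_link_add_le {p : ι → E} (hp : IsNeighborlyConfig p)
    (hspan : Submodule.span ℝ (Set.range p) = ⊤) (hE : Module.finrank ℝ E = 6)
    (hι : 4 ≤ Fintype.card ι) {e : Finset ι} (he : e.card = 2) :
    ∑ F ∈ (configFacets p).filter (e ⊆ ·), ((linkVertices p e).filter (· ∈ F)).card + 12 ≤
      6 * ((configFacets p).filter (e ⊆ ·)).card := by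
  obtain ⟨h, g, hh, hhe, hge, hinj⟩ := hp.exists_pencil he
  set s : ι → ℝ := fun w => g (p w) / h (p w) with hs
  have hpos : ∀ a, a ∉ e → 0 < h (p a) := fun a ha =>
    lt_of_le_of_ne (hh a) fun h0 => ha ((hhe a).1 h0.symm)
  have hgs : ∀ a, a ∉ e → g (p a) = s a * h (p a) := fun a ha =>
    (div_mul_cancel₀ _ (hpos a ha).ne').symm
  set 𝒢 := (configFacets p).filter (e ⊆ ·) with h𝒢
  set L := linkVertices p e with hL
  let top : ι → Finset ι → Prop := fun w F => w ∈ F ∧ ∀ a ∈ F, a ∉ e → s a ≤ s w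
  let bot : ι → Finset ι → Prop := fun w F => w ∈ F ∧ ∀ a ∈ F, a ∉ e → s w ≤ s a
  classical
  have hfilter : ∀ w, 𝒢.filter (w ∈ ·) = (configFacets p).filter (insert w e ⊆ ·) := by
    intro w
    ext F
    simp [h𝒢, Finset.insert_subset_iff]
    tauto
  have hthree : ∀ w ∈ L, 3 ≤ (𝒢.filter (w ∈ ·)).card := by
    intro w hw
    obtain ⟨hwe, hface⟩ := mem_linkVertices.1 hw
    have h1 := hface.finrank_le_card_facets hspan
    have hcard : (insert w e).card = 3 := by
      rw [Finset.card_insert_of_notMem hwe, he]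
    rw [finrank_span_image_of_linearIndepOn (hp.linearIndepOn (by omega)), hE, hcard] at h1
    rw [hfilter]
    omega
  have hsplit : ∀ w ∈ L, (𝒢.filter (w ∈ ·)).card ≤
      (𝒢.filter (top w)).card + (𝒢.filter (bot w)).card + 2 := by
    intro w hw
    obtain ⟨hwe, hface⟩ := mem_linkVertices.1 hw
    have hcard : (insert w e).card = 3 := by
      rw [Finset.card_insert_of_notMem hwe, he]
    have hγ : ∀ a, a ∉ e → (g - s w • h) (p a) = (s a - s w) * h (p a) := by
      intro a ha
      simp only [LinearMap.sub_apply, LinearMap.smul_apply, smul_eq_mul, hgs a ha]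
      ring
    have hmix := hp.card_mixed_facets_le hspan hE hcard (γ := g - s w • h) (by
      intro i hi
      rcases Finset.mem_insert.1 hi with rfl | hi
      · rw [hγ i hwe, sub_self, zero_mul]
      · simp [hge i hi, (hhe i).2 hi])
    rw [← hfilter] at hmix
    have hsub : 𝒢.filter (w ∈ ·) ⊆ (𝒢.filter (top w) ∪ 𝒢.filter (bot w)) ∪
        ((𝒢.filter (w ∈ ·)).filter fun F =>
          (∃ a ∈ F, 0 < (g - s w • h) (p a)) ∧ ∃ b ∈ F, (g - s w • h) (p b) < 0) := by
      intro F hF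
      obtain ⟨hF𝒢, hwF⟩ := Finset.mem_filter.1 hF
      by_cases h1 : top w F
      · simp [hF𝒢, h1]
      by_cases h2 : bot w F
      · simp [hF𝒢, h2]
      simp only [top, bot, hwF, true_and] at h1 h2
      push Not at h1 h2
      obtain ⟨a, haF, hae, ha⟩ := h1
      obtain ⟨b, hbF, hbe, hb⟩ := h2
      refine Finset.mem_union_right _ (Finset.mem_filter.2 ⟨hF, ⟨a, haF, ?_⟩, b, hbF, ?_⟩)
      · rw [hγ a hae]
        exact mul_pos (by linarith) (hpos a hae)
      · rw [hγ b hbe]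
        exact mul_neg_of_neg_of_pos (by linarith) (hpos b hbe)
    have h1 := Finset.card_le_card hsub
    have h2 := Finset.card_union_le (𝒢.filter (top w) ∪ 𝒢.filter (bot w))
      ((𝒢.filter (w ∈ ·)).filter fun F =>
          (∃ a ∈ F, 0 < (g - s w • h) (p a)) ∧ ∃ b ∈ F, (g - s w • h) (p b) < 0)
    have h3 := Finset.card_union_le (𝒢.filter (top w)) (𝒢.filter (bot w))
    omega
  have hcompl : 2 ≤ eᶜ.card := by
    rw [Finset.card_compl]
    omega
  have hcne : eᶜ.Nonempty := Finset.card_pos.1 (by omega)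
  obtain ⟨M, hM, hMmax⟩ := Finset.exists_max_image eᶜ s hcne
  obtain ⟨m, hm, hmmin⟩ := Finset.exists_min_image eᶜ s hcne
  simp only [Finset.mem_compl] at hM hm hMmax hmmin
  have hMm : M ≠ m := by
    rintro rfl
    obtain ⟨a, ha, b, hb, hab⟩ := Finset.one_lt_card.1 (by omega : 1 < eᶜ.card)
    simp only [Finset.mem_compl] at ha hb
    exact hab (hinj a b ha hb (le_antisymm ((hMmax a ha).trans (hmmin b hb))
      ((hMmax b hb).trans (hmmin a ha))))
  have extreme : ∀ (w : ι) (ε : ℝ), w ∉ e → ε ≠ 0 → (∀ a, a ∉ e → 0 ≤ ε * (s w - s a)) →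
      w ∈ L := by
    intro w ε hw hε hext
    have hval : ∀ a, a ∉ e → (ε • (s w • h - g)) (p a) = ε * (s w - s a) * h (p a) := by
      intro a ha
      simp only [LinearMap.sub_apply, LinearMap.smul_apply, smul_eq_mul, hgs a ha]
      ring
    have hval0 : ∀ a ∈ e, (ε • (s w • h - g)) (p a) = 0 := by
      intro a ha
      simp [hge a ha, (hhe a).2 ha]
    refine mem_linkVertices.2 ⟨hw, ε • (s w • h - g), fun i => ?_, fun i => ?_⟩
    · by_cases hi : i ∈ e
      · exact (hval0 i hi).ge
      · rw [hval i hi]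
        exact mul_nonneg (hext i hi) (hh _)
    · by_cases hi : i ∈ e
      · simp only [hval0 i hi, Finset.mem_insert, hi, or_true]
      · rw [hval i hi, Finset.mem_insert, or_iff_left hi]
        constructor
        · intro h0
          have h1 := (mul_eq_zero.1 h0).resolve_right (hpos i hi).ne'
          have h2 := (mul_eq_zero.1 h1).resolve_left hε
          exact hinj i w hi hw (by simp only [hs] at h2; linarith)
        · rintro rfl
          simp
  have hML : M ∈ L := extreme M 1 hM one_ne_zero fun a ha => by linarith [hMmax a ha]
  have hmL : m ∈ L := extreme m (-1) hm (by norm_num) fun a ha => by linarith [hmmin a ha]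
  have hMtop : 𝒢.filter (M ∈ ·) ⊆ 𝒢.filter (top M) := fun F hF => by
    obtain ⟨h1, h2⟩ := Finset.mem_filter.1 hF
    exact Finset.mem_filter.2 ⟨h1, h2, fun a _ ha => hMmax a ha⟩
  have hmbot : 𝒢.filter (m ∈ ·) ⊆ 𝒢.filter (bot m) := fun F hF => by
    obtain ⟨h1, h2⟩ := Finset.mem_filter.1 hF
    exact Finset.mem_filter.2 ⟨h1, h2, fun a _ ha => hmmin a ha⟩
  have hlocal : ∀ w ∈ L, (𝒢.filter (w ∈ ·)).card +
      ((if w = M then 6 else 0) + (if w = m then 6 else 0)) ≤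
      3 * ((𝒢.filter (top w)).card + (𝒢.filter (bot w)).card) := by
    intro w hw
    have h3 := hthree w hw
    have h4 := hsplit w hw
    by_cases hwM : w = M
    · subst hwM
      have := Finset.card_le_card hMtop
      simp only [if_true, if_neg hMm]
      omega
    · by_cases hwm : w = m
      · subst hwm
        have := Finset.card_le_card hmbot
        simp only [if_true, if_neg hwM]
        omega
      · simp only [if_neg hwM, if_neg hwm]
        omega
  have huniq : ∀ F ∈ 𝒢, (L.filter fun w => top w F).card ≤ 1 ∧
      (L.filter fun w => bot w F).card ≤ 1 := by
    intro F _
    constructor <;> refine Finset.card_le_one.2 fun a ha b hb => ?_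
    all_goals
      obtain ⟨haL, haF, ha⟩ := Finset.mem_filter.1 ha
      obtain ⟨hbL, hbF, hb⟩ := Finset.mem_filter.1 hb
      have hae := (mem_linkVertices.1 haL).1
      have hbe := (mem_linkVertices.1 hbL).1
      have h1 := ha b hbF hbe
      have h2 := hb a haF hae
      exact hinj a b hae hbe (by simp only [hs] at h1 h2; linarith)
  have hsum := Finset.sum_le_sum hlocal
  rw [Finset.sum_add_distrib, Finset.sum_add_distrib, ← Finset.mul_sum,
    Finset.sum_add_distrib, Finset.sum_ite_eq' L M, Finset.sum_ite_eq' L m,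
    if_pos hML, if_pos hmL] at hsum
  have swap : ∀ (r : ι → Finset ι → Prop) [∀ w F, Decidable (r w F)],
      ∑ w ∈ L, (𝒢.filter (r w)).card = ∑ F ∈ 𝒢, (L.filter fun w => r w F).card := fun r _ =>
    Finset.sum_card_bipartiteAbove_eq_sum_card_bipartiteBelow r
  have htops : ∑ w ∈ L, (𝒢.filter (top w)).card ≤ 𝒢.card := by
    rw [swap, Finset.card_eq_sum_ones]
    exact Finset.sum_le_sum fun F hF => (huniq F hF).1
  have hbots : ∑ w ∈ L, (𝒢.filter (bot w)).card ≤ 𝒢.card := by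
    rw [swap, Finset.card_eq_sum_ones]
    exact Finset.sum_le_sum fun F hF => (huniq F hF).2
  have hinc := swap fun w F => w ∈ F
  omega

omit [DecidableEq ι] in
/-- In rank five, every facet of a 2-neighborly configuration has four elements. -/
lemma IsNeighborlyConfig.card_facet_eq_four {p : ι → E} (hp : IsNeighborlyConfig p)
    (hE : Module.finrank ℝ E = 5) {H : Finset ι} (hH : IsFacetSet p H) : H.card = 4 := by
  have hrank := hH.2
  rw [hE] at hrank
  by_cases h5 : H.card ≤ 5
  · rw [finrank_span_image_of_linearIndepOn (hp.linearIndepOn h5)] at hrank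
    omega
  · obtain ⟨S, hSH, hS⟩ := Finset.exists_subset_card_eq (by omega : 5 ≤ H.card)
    have h1 := Submodule.finrank_mono (Submodule.span_mono (R := ℝ)
      (Set.image_mono (f := p) (by simpa using hSH : (S : Set ι) ⊆ H)))
    rw [finrank_span_image_of_linearIndepOn (hp.linearIndepOn hS.le)] at h1
    omega

/-- Coordinates adapted to a simplicial facet: the normalized facet functional, and the
coordinates with respect to the basis formed by the facet and the sum of all vectors. -/
lemma IsFacetSet.exists_coordinates {p : ι → E} (hspan : Submodule.span ℝ (Set.range p) = ⊤)
    {H : Finset ι} (hH : IsFacetSet p H) (hind : LinearIndepOn ℝ p (H : Set ι)) :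
    ∃ (φ : Module.Dual ℝ E) (β : ι → Module.Dual ℝ E), (∀ i, 0 ≤ φ (p i)) ∧
      (∀ i, φ (p i) = 0 ↔ i ∈ H) ∧ φ (∑ i, p i) = 1 ∧ (∀ w ∈ H, β w ≠ 0) ∧
      ∀ y, y = φ y • ∑ i, p i + ∑ w ∈ H, β w y • p w := by
  obtain ⟨φ, hφ, hφH⟩ := hH.1
  set o := ∑ i, p i with ho
  have hpos : 0 < φ o := by
    rw [ho, map_sum]
    refine lt_of_le_of_ne (Finset.sum_nonneg fun i _ => hφ i) fun h => ?_
    have hall := (Finset.sum_eq_zero_iff_of_nonneg fun i _ => hφ i).1 h.symm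
    have hφ0 : φ = 0 := LinearMap.ext_on_range hspan fun i => by simpa using hall i (by simp)
    have hker := hH.ker_eq hspan hφH
    rw [hφ0, LinearMap.ker_zero] at hker
    have := hH.2
    rw [← hker, finrank_top] at this
    omega
  choose χ hχ using fun w : ι =>
    exists_dual_apply_eq_of_linearIndepOn hind fun i => if i = w then 1 else 0
  let φ' : Module.Dual ℝ E := (φ o)⁻¹ • φ
  have hφ'H : ∀ i, φ' (p i) = 0 ↔ i ∈ H := fun i => by simp [φ', hpos.ne', hφH]
  have hφ'o : φ' o = 1 := by simp [φ', hpos.ne']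
  let β : ι → Module.Dual ℝ E := fun w => χ w - χ w o • φ'
  have hβo : ∀ w, β w o = 0 := fun w => by simp [β, hφ'o]
  have hβ : ∀ w, ∀ i ∈ H, β w (p i) = if i = w then 1 else 0 := fun w i hi => by
    simp [β, (hφ'H i).2 hi, hχ w i hi]
  have hexp : ∀ z ∈ Submodule.span ℝ (p '' (H : Set ι)), ∑ w ∈ H, β w z • p w = z := by
    intro z hz
    induction hz using Submodule.span_induction with
    | mem x hx =>
      obtain ⟨i, hi, rfl⟩ := hx
      rw [Finset.sum_congr rfl fun w _ => by rw [hβ w i hi]]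
      have : i ∈ H := hi
      simp [ite_smul, this]
    | zero => simp
    | add x y _ _ hx hy =>
      simp only [map_add, add_smul, Finset.sum_add_distrib, hx, hy]
    | smul a x _ hx =>
      simp only [map_smul, smul_assoc, ← Finset.smul_sum, hx]
  refine ⟨φ', β, fun i => ?_, hφ'H, hφ'o, fun w hw h0 => ?_, fun y => ?_⟩
  · exact mul_nonneg (inv_nonneg.2 hpos.le) (hφ i)
  · have := hβ w w hw
    simp [h0] at this
  · have hz : y - φ' y • o ∈ Submodule.span ℝ (p '' (H : Set ι)) := by
      rw [← hH.ker_eq hspan hφ'H]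
      simp [hφ'o]
    have := hexp _ hz
    simp only [map_sub, map_smul, hβo, smul_zero, sub_zero] at this
    rw [this]
    abel

/-- The shelling induced by a generic direction: every face with at most two elements is minimal
in exactly one facet. -/
lemma IsNeighborlyConfig.card_restriction_le_eq_one {p : ι → E} (hp : IsNeighborlyConfig p)
    (hspan : Submodule.span ℝ (Set.range p) = ⊤) (hE : Module.finrank ℝ E = 5)
    {φ : Finset ι → Module.Dual ℝ E} {β : Finset ι → ι → Module.Dual ℝ E}
    (hφ : ∀ H, IsFacetSet p H → ∀ i, 0 ≤ φ H (p i))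
    (hφH : ∀ H, IsFacetSet p H → ∀ i, φ H (p i) = 0 ↔ i ∈ H)
    (hφo : ∀ H, IsFacetSet p H → φ H (∑ i, p i) = 1)
    (hβ : ∀ H, IsFacetSet p H → ∀ y, y = φ H y • ∑ i, p i + ∑ w ∈ H, β H w y • p w)
    {y : E} (hy : ∀ H, IsFacetSet p H → ∀ w ∈ H, β H w y ≠ 0)
    {S : Finset ι} (hS : S.card ≤ 2) :
    ((configFacets p).filter fun H => S ⊆ H ∧ ∀ w ∈ H, 0 < β H w y → w ∈ S).card = 1 := by
  have hcompare : ∀ H G, IsFacetSet p H → IsFacetSet p G →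
      φ G y = φ H y + ∑ w ∈ H, β H w y * φ G (p w) := by
    intro H G hH hG
    have := congrArg (φ G) (hβ H hH y)
    simpa [hφo G hG] using this
  have hterm : ∀ H G, IsFacetSet p G → S ⊆ G →
      (∀ w ∈ H, 0 < β H w y → w ∈ S) → ∀ w ∈ H, β H w y * φ G (p w) ≤ 0 := by
    intro H G hG hSG hR w hw
    by_cases h0 : 0 < β H w y
    · rw [(hφH G hG w).2 (hSG (hR w hw h0)), mul_zero]
    · exact mul_nonpos_of_nonpos_of_nonneg (not_lt.1 h0) (hφ G hG _)
  refine le_antisymm (Finset.card_le_one.2 fun H hH G hG => ?_) (Finset.card_pos.2 ?_)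
  · simp only [Finset.mem_filter, mem_configFacets] at hH hG
    obtain ⟨hH, hSH, hRH⟩ := hH
    obtain ⟨hG, hSG, hRG⟩ := hG
    have h1 := hcompare H G hH hG
    have h2 := hcompare G H hG hH
    have h3 := Finset.sum_nonpos (hterm H G hG hSG hRH)
    have h4 := Finset.sum_nonpos (hterm G H hH hSH hRG)
    have h5 := (Finset.sum_eq_zero_iff_of_nonpos (hterm H G hG hSG hRH)).1 (by linarith)
    refine Finset.eq_of_subset_of_card_le (fun w hw => ?_) ?_
    · exact (hφH G hG w).1 ((mul_eq_zero.1 (h5 w hw)).resolve_left (hy H hH w hw))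
    · rw [hp.card_facet_eq_four hE hH, hp.card_facet_eq_four hE hG]
  · have hne : ((configFacets p).filter (S ⊆ ·)).Nonempty := by
      have := (hp S hS).finrank_le_card_facets hspan
      rw [finrank_span_image_of_linearIndepOn (hp.linearIndepOn (by omega)), hE] at this
      exact Finset.card_pos.1 (by omega)
    obtain ⟨H, hH, hmax⟩ := Finset.exists_max_image _ (fun H => φ H y) hne
    simp only [Finset.mem_filter, mem_configFacets] at hH hmax
    obtain ⟨hH, hSH⟩ := hH
    refine ⟨H, Finset.mem_filter.2 ⟨mem_configFacets.2 hH, hSH, fun w hw hβw => ?_⟩⟩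
    by_contra hwS
    have hcard := hp.card_facet_eq_four hE hH
    obtain ⟨χ, hχ⟩ := exists_dual_apply_eq_of_linearIndepOn
      (hp.linearIndepOn (S := H) (by omega)) fun i => if i = w then 1 else 0
    have hface : IsFaceSet p (H.erase w) := by
      refine hH.1.of_face (Finset.erase_subset w H) χ (fun i hi => ?_) fun i hi hiw => ?_
      · rw [hχ i (Finset.mem_of_mem_erase hi), if_neg (Finset.ne_of_mem_erase hi)]
      · have : i = w := by
          by_contra h
          exact hiw (Finset.mem_erase.2 ⟨h, hi⟩)
        rw [hχ i hi, if_pos this]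
        exact one_pos
    have hcard' : (H.erase w).card = 3 := by rw [Finset.card_erase_of_mem hw, hcard]
    have h1 := hface.finrank_le_card_facets hspan
    rw [finrank_span_image_of_linearIndepOn (hp.linearIndepOn (by omega)), hE, hcard'] at h1
    obtain ⟨G, hG, hGH⟩ := Finset.exists_mem_ne (by omega :
      1 < ((configFacets p).filter (H.erase w ⊆ ·)).card) H
    simp only [Finset.mem_filter, mem_configFacets] at hG
    obtain ⟨hG, heG⟩ := hG
    have hwG : w ∉ G := fun h => hGH <| Eq.symm <| Finset.eq_of_subset_of_card_le
      (by rw [← Finset.insert_erase hw]; exact Finset.insert_subset h heG)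
      (by rw [hcard, hp.card_facet_eq_four hE hG])
    have hSG : S ⊆ G := fun i hi =>
      heG (Finset.mem_erase.2 ⟨fun h => hwS (h ▸ hi), hSH hi⟩)
    have h2 := hmax G ⟨hG, hSG⟩
    have h3 := hcompare H G hH hG
    rw [Finset.sum_eq_single_of_mem w hw fun i hi hiw => by
      rw [(hφH G hG i).2 (heG (Finset.mem_erase.2 ⟨hiw, hi⟩)), mul_zero]] at h3
    have h4 : 0 < φ G (p w) :=
      lt_of_le_of_ne (hφ G hG w) fun h => hwG ((hφH G hG w).1 h.symm)
    have := mul_pos hβw h4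
    linarith

omit [Fintype ι] in
lemma card_powersetCard_filter_between {U R H : Finset ι} (hRH : R ⊆ H) (hHU : H ⊆ U) (j : ℕ) :
    ((Finset.powersetCard j U).filter fun S => S ⊆ H ∧ R ⊆ S).card =
      if R.card ≤ j then (H.card - R.card).choose (j - R.card) else 0 := by
  split_ifs with hj
  · rw [← Finset.card_sdiff_of_subset hRH, ← Finset.card_powersetCard]
    refine Finset.card_nbij' (· \ R) (· ∪ R) ?_ ?_ ?_ ?_
    · intro S hS
      simp only [Finset.mem_coe, Finset.mem_filter, Finset.mem_powersetCard] at hS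
      simp only [Finset.mem_coe,
        Finset.mem_powersetCard]
      obtain ⟨⟨-, hS⟩, hSH, hRS⟩ := hS
      exact ⟨Finset.sdiff_subset_sdiff hSH subset_rfl, by
        rw [Finset.card_sdiff_of_subset hRS, hS]⟩
    · intro T hT
      simp only [Finset.mem_coe, Finset.mem_powersetCard] at hT
      simp only [Finset.mem_coe, Finset.mem_filter, Finset.mem_powersetCard]
      obtain ⟨hTH, hT⟩ := hT
      have hTH' : T ∪ R ⊆ H := Finset.union_subset (hTH.trans Finset.sdiff_subset) hRH
      refine ⟨⟨hTH'.trans hHU, ?_⟩, hTH', Finset.subset_union_right⟩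
      rw [Finset.card_union_of_disjoint (Finset.disjoint_of_subset_left hTH
        Finset.sdiff_disjoint), hT]
      omega
    · intro S hS
      simp only [Finset.mem_coe, Finset.mem_filter, Finset.mem_powersetCard] at hS
      exact Finset.sdiff_union_of_subset hS.2.2
    · intro T hT
      simp only [Finset.mem_coe, Finset.mem_powersetCard] at hT
      exact Finset.union_sdiff_cancel_right (Finset.disjoint_of_subset_left hT.1
        Finset.sdiff_disjoint)
  · rw [Finset.card_eq_zero, Finset.filter_eq_empty_iff]
    rintro S hS ⟨-, hRS⟩
    exact hj ((Finset.card_le_card hRS).trans (Finset.mem_powersetCard.1 hS).2.le)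

/-- The number of facets of a 2-neighborly configuration of rank five. -/
lemma IsNeighborlyConfig.card_facets_add_card {p : ι → E} (hp : IsNeighborlyConfig p)
    (hspan : Submodule.span ℝ (Set.range p) = ⊤) (hE : Module.finrank ℝ E = 5) :
    (configFacets p).card + Fintype.card ι = (Fintype.card ι).choose 2 := by
  have hcoord : ∀ H, ∃ (φ : Module.Dual ℝ E) (β : ι → Module.Dual ℝ E), IsFacetSet p H →
      (∀ i, 0 ≤ φ (p i)) ∧ (∀ i, φ (p i) = 0 ↔ i ∈ H) ∧ φ (∑ i, p i) = 1 ∧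
      (∀ w ∈ H, β w ≠ 0) ∧ ∀ y, y = φ y • ∑ i, p i + ∑ w ∈ H, β w y • p w := by
    intro H
    by_cases hH : IsFacetSet p H
    · obtain ⟨φ, β, h⟩ := hH.exists_coordinates hspan
        (hp.linearIndepOn (by have := hp.card_facet_eq_four hE hH; omega))
      exact ⟨φ, β, fun _ => h⟩
    · exact ⟨0, 0, fun h => absurd h hH⟩
  choose φ β hφ hφH hφo hβ0 hβ using hcoord
  obtain ⟨y, hy⟩ := Module.Dual.exists_forall_ne_zero_of_forall_exists
    (fun k : {k : Finset ι × ι // IsFacetSet p k.1 ∧ k.2 ∈ k.1} => β k.1.1 k.1.2) (by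
      rintro ⟨⟨H, w⟩, hH, hw⟩
      by_contra! h
      exact hβ0 H hH w hw (LinearMap.ext h))
  replace hy : ∀ H, IsFacetSet p H → ∀ w ∈ H, β H w y ≠ 0 := fun H hH w hw =>
    hy ⟨⟨H, w⟩, hH, hw⟩
  let R : Finset ι → Finset ι := fun H => H.filter fun w => 0 < β H w y
  have count : ∀ (Q : Finset ι → Finset ι), (∀ H, Q H ⊆ H) →
      (∀ S : Finset ι, S.card ≤ 2 →
        ((configFacets p).filter fun H => S ⊆ H ∧ Q H ⊆ S).card = 1) → ∀ j ≤ 2,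
      ∑ H ∈ configFacets p, (if (Q H).card ≤ j then (4 - (Q H).card).choose (j - (Q H).card)
        else 0) = (Fintype.card ι).choose j := by
    intro Q hQ hQ1 j hj
    have h1 := Finset.sum_card_bipartiteAbove_eq_sum_card_bipartiteBelow
      (s := Finset.powersetCard j Finset.univ) (t := configFacets p)
      (fun S H => S ⊆ H ∧ Q H ⊆ S)
    simp only [Finset.bipartiteAbove, Finset.bipartiteBelow] at h1
    rw [Finset.sum_congr rfl fun S hS => hQ1 S
      ((Finset.mem_powersetCard.1 hS).2.le.trans hj), ← Finset.card_eq_sum_ones,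
      Finset.card_powersetCard, Finset.card_univ] at h1
    rw [h1]
    refine Finset.sum_congr rfl fun H hH => ?_
    rw [card_powersetCard_filter_between (hQ H) (Finset.subset_univ H),
      hp.card_facet_eq_four hE (mem_configFacets.1 hH)]
  have hR := count R (fun H => Finset.filter_subset _ _) fun S hS => by
    rw [← hp.card_restriction_le_eq_one hspan hE hφ hφH hφo hβ hy hS]
    congr 1
    refine Finset.filter_congr fun H _ => and_congr_right fun _ => ?_
    simp [R, Finset.subset_iff]
  have hR' := count (fun H => H \ R H) (fun H => Finset.sdiff_subset) fun S hS => by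
    rw [← hp.card_restriction_le_eq_one hspan hE hφ hφH hφo hβ (y := -y)
      (fun H hH w hw => by simpa using hy H hH w hw) hS]
    congr 1
    refine Finset.filter_congr fun H hH => and_congr_right fun _ => ?_
    simp only [R, Finset.subset_iff, Finset.mem_sdiff, Finset.mem_filter, not_and, not_lt,
      map_neg, Left.neg_pos_iff, and_imp]
    refine forall_congr' fun w => forall_congr' fun hw => ?_
    have := (hy H (mem_configFacets.1 hH) w hw).le_iff_lt
    simp only [hw, forall_const, this]
  have hlocal : ∀ H ∈ configFacets p,
      1 + 2 * (if (R H).card ≤ 1 then (4 - (R H).card).choose (1 - (R H).card) else 0) +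
        3 * (if (H \ R H).card ≤ 0 then (4 - (H \ R H).card).choose (0 - (H \ R H).card) else 0) =
      (if (R H).card ≤ 2 then (4 - (R H).card).choose (2 - (R H).card) else 0) +
        3 * (if (R H).card ≤ 0 then (4 - (R H).card).choose (0 - (R H).card) else 0) +
        (if (H \ R H).card ≤ 1 then (4 - (H \ R H).card).choose (1 - (H \ R H).card) else 0) := by
    intro H hH
    have h0 : R H ⊆ H := Finset.filter_subset _ _
    have h1 := Finset.card_sdiff_add_card_eq_card h0
    rw [hp.card_facet_eq_four hE (mem_configFacets.1 hH)] at h1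
    obtain ⟨h2, h3⟩ : (H \ R H).card = 4 - (R H).card ∧ (R H).card ≤ 4 := by omega
    rw [h2]
    generalize (R H).card = r at *
    interval_cases r <;> decide
  have hsum := Finset.sum_congr rfl hlocal
  simp only [Finset.sum_add_distrib, ← Finset.mul_sum] at hsum
  rw [hR 2 le_rfl, hR 1 (by norm_num), hR 0 (by norm_num), hR' 1 (by norm_num),
    hR' 0 (by norm_num), ← Finset.card_eq_sum_ones] at hsum
  simp only [Nat.choose_one_right, Nat.choose_zero_right] at hsum
  omega

omit [Fintype ι] [FiniteDimensional ℝ E] [DecidableEq ι] in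
lemma span_range_codRestrict_eq_top {q : ι → E} {W : Submodule ℝ E} (hq : ∀ i, q i ∈ W)
    (hW : Submodule.span ℝ (Set.range q) = W) :
    Submodule.span ℝ (Set.range fun i => (⟨q i, hq i⟩ : W)) = ⊤ := by
  apply Submodule.map_injective_of_injective (Submodule.injective_subtype _)
  rw [Submodule.map_span, Submodule.map_top, Submodule.range_subtype, ← Set.range_comp]
  exact hW

/-- A facet with many elements forces many facets. -/
lemma IsNeighborlyConfig.fifteen_le_card_of_seven_le {p : ι → E} (hp : IsNeighborlyConfig p)
    (hspan : Submodule.span ℝ (Set.range p) = ⊤) (hE : Module.finrank ℝ E = 6)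
    {F : Finset ι} (hF : IsFacetSet p F) (hF7 : 7 ≤ F.card) : 15 ≤ (configFacets p).card := by
  let E' := Submodule.span ℝ (p '' (F : Set ι))
  let q : F → E' := fun i => ⟨p i, Submodule.subset_span ⟨i, i.2, rfl⟩⟩
  have hE' : Module.finrank ℝ E' = 5 := by
    have := hF.2
    rw [hE] at this
    exact Nat.succ_injective this
  have hq : IsNeighborlyConfig q := by
    intro S hS
    obtain ⟨φ, hφ, hφS⟩ := hp (S.map (Function.Embedding.subtype _)) (by simpa using hS)
    refine ⟨φ.domRestrict E', fun i => hφ i, fun i => ?_⟩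
    rw [LinearMap.domRestrict_apply, hφS]
    simp
  have hcount := hq.card_facets_add_card (span_range_codRestrict_eq_top _
    (congrArg (Submodule.span ℝ) (Set.image_eq_range p (F : Set ι)).symm)) hE'
  rw [Fintype.card_coe] at hcount
  have hsub : ∀ H : Finset F, H.map (Function.Embedding.subtype _) ⊆ F := by
    intro H i hi
    obtain ⟨j, -, rfl⟩ := Finset.mem_map.1 hi
    exact j.2
  have hneighbor : ∀ H : Finset F, ∃ G, IsFacetSet q H →
      IsFacetSet p G ∧ G ≠ F ∧ G ∩ F = H.map (Function.Embedding.subtype _) := by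
    intro H
    by_cases hH : IsFacetSet q H
    · set T := H.map (Function.Embedding.subtype _) with hT
      have hTcard : T.card = 4 := by
        rw [hT, Finset.card_map, hq.card_facet_eq_four hE' hH]
      have hTface : IsFaceSet p T := by
        obtain ⟨φ, hφ, hφH⟩ := hH.1
        obtain ⟨χ, hχ⟩ := LinearMap.exists_extend φ
        have hval : ∀ i (hi : i ∈ F), χ (p i) = φ (q ⟨i, hi⟩) := fun i hi =>
          LinearMap.congr_fun hχ (q ⟨i, hi⟩)
        refine hF.1.of_face (hsub H) χ (fun i hi => ?_) fun i hi hiT => ?_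
        · obtain ⟨j, hj, rfl⟩ := Finset.mem_map.1 hi
          exact (hval j j.2).trans ((hφH j).2 hj)
        · rw [hval i hi]
          refine lt_of_le_of_ne (hφ _) fun h => hiT ?_
          exact Finset.mem_map.2 ⟨⟨i, hi⟩, (hφH _).1 h.symm, rfl⟩
      have h1 := hTface.finrank_le_card_facets hspan
      rw [finrank_span_image_of_linearIndepOn (hp.linearIndepOn (by omega)), hE, hTcard] at h1
      obtain ⟨G, hG, hGF⟩ := Finset.exists_mem_ne (by omega :
        1 < ((configFacets p).filter (T ⊆ ·)).card) F
      simp only [Finset.mem_filter, mem_configFacets] at hG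
      obtain ⟨hG, hTG⟩ := hG
      refine ⟨G, fun _ => ⟨hG, hGF, ?_⟩⟩
      refine subset_antisymm (fun w hw => ?_) (Finset.subset_inter hTG (hsub H))
      by_contra hwT
      obtain ⟨hwG, hwF⟩ := Finset.mem_inter.1 hw
      have h5 : (insert w T).card = 5 := by rw [Finset.card_insert_of_notMem hwT, hTcard]
      exact hGF (hp.facet_unique hspan hG hF (Finset.insert_subset hwG hTG)
        (Finset.insert_subset hwF (hsub H)) h5.le (by omega))
    · exact ⟨∅, fun h => absurd h hH⟩
  choose G hG hGF hGH using hneighbor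
  have hle : (configFacets q).card ≤ ((configFacets p).erase F).card := by
    refine Finset.card_le_card_of_injOn G (fun H hH => ?_) fun H hH H' hH' hHH' => ?_
    · have hH := mem_configFacets.1 hH
      exact Finset.mem_erase.2 ⟨hGF H hH, mem_configFacets.2 (hG H hH)⟩
    · have h1 := hGH H (mem_configFacets.1 hH)
      have h2 := hGH H' (mem_configFacets.1 hH')
      rw [hHH', h2] at h1
      exact (Finset.map_injective _ h1).symm
  rw [Finset.card_erase_of_mem (mem_configFacets.2 hF)] at hle
  have hchoose : F.card + 14 ≤ F.card.choose 2 := by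
    obtain ⟨m, hm⟩ := Nat.exists_eq_add_of_le hF7
    rw [hm, Nat.choose_two_right, Nat.le_div_iff_mul_le two_pos,
      show 7 + m - 1 = 6 + m by omega]
    nlinarith
  omega

omit [FiniteDimensional ℝ E] in
/-- Subsets of a linearly independent face are faces. -/
lemma IsFaceSet.of_linearIndepOn {p : ι → E} {F S : Finset ι} (hF : IsFaceSet p F)
    (hind : LinearIndepOn ℝ p (F : Set ι)) (hSF : S ⊆ F) : IsFaceSet p S := by
  obtain ⟨χ, hχ⟩ := exists_dual_apply_eq_of_linearIndepOn hind fun i => if i ∈ S then 0 else 1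
  refine hF.of_face hSF χ (fun i hi => ?_) fun i hi hiS => ?_
  · rw [hχ i (hSF hi), if_pos hi]
  · rw [hχ i hi, if_neg hiS]
    exact one_pos

omit [FiniteDimensional ℝ E] in
/-- A facet of rank five with six elements has at most two missing triangles. -/
lemma IsNeighborlyConfig.exists_missing_triangles {p : ι → E} (hp : IsNeighborlyConfig p)
    (hE : Module.finrank ℝ E = 6) {F : Finset ι} (hF : IsFacetSet p F) (hF6 : F.card = 6) :
    ∃ A B : Finset ι, A.card = 3 ∧ B.card = 3 ∧ A ⊆ F ∧ B ⊆ F ∧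
      ∀ S ⊆ F, S.card = 3 → S ≠ A → S ≠ B → IsFaceSet p S := by
  have hdep : ¬ LinearIndepOn ℝ p (F : Set ι) := fun h => by
    have h1 := hF.2
    rw [finrank_span_image_of_linearIndepOn h] at h1
    omega
  rw [linearIndepOn_finset_iff] at hdep
  push Not at hdep
  obtain ⟨f, hf, j, hjF, hfj⟩ := hdep
  let c : ι → ℝ := fun i => if i ∈ F then f i else 0
  have hc : ∑ i, c i • p i = 0 := by
    rw [← hf]
    simp [c, ite_smul, Finset.sum_ite_mem]
  have hcne : ∃ i, c i ≠ 0 := ⟨j, by simpa [c, hjF] using hfj⟩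
  have hA3 := hp.three_le_card_pos hc hcne
  have hB3 := hp.three_le_card_neg hc hcne
  set A := Finset.univ.filter fun i => 0 < c i with hA
  set B := Finset.univ.filter fun i => c i < 0 with hB
  have hAc : ∀ i, i ∈ A ↔ 0 < c i := fun i => by simp [hA]
  have hBc : ∀ i, i ∈ B ↔ c i < 0 := fun i => by simp [hB]
  have hdisj : Disjoint A B := by
    rw [Finset.disjoint_left]
    intro i hi hi'
    have h1 := (hAc i).1 hi
    have h2 := (hBc i).1 hi'
    linarith
  have hcF : ∀ i, i ∉ F → c i = 0 := fun i hi => by simp [c, hi]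
  have hAF : A ⊆ F := fun i hi => by
    by_contra h
    exact ((hAc i).1 hi).ne' (hcF i h)
  have hBF : B ⊆ F := fun i hi => by
    by_contra h
    exact ((hBc i).1 hi).ne (hcF i h)
  have hcard := Finset.card_le_card (Finset.union_subset hAF hBF)
  have hunion := Finset.card_union_of_disjoint hdisj
  have hABF : A ∪ B = F :=
    Finset.eq_of_subset_of_card_le (Finset.union_subset hAF hBF) (by omega)
  refine ⟨A, B, by omega, by omega, hAF, hBF, fun S hSF hS hSA hSB => ?_⟩
  have hnonempty : ∀ C : Finset ι, C.card = 3 → S ≠ C → (C \ S).Nonempty := by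
    intro C hC hSC
    rw [Finset.sdiff_nonempty]
    intro h
    exact hSC (Finset.eq_of_subset_of_card_le h (by omega)).symm
  have hAS := hnonempty A (by omega) hSA
  have hBS := hnonempty B (by omega) hSB
  set a := ∑ i ∈ A \ S, c i with ha
  set b := ∑ i ∈ B \ S, c i with hb
  have ha0 : 0 < a := Finset.sum_pos (fun i hi => (hAc i).1 (Finset.mem_sdiff.1 hi).1) hAS
  have hb0 : b < 0 := Finset.sum_neg (fun i hi => (hBc i).1 (Finset.mem_sdiff.1 hi).1) hBS
  let x : ι → ℝ := fun i => if i ∈ S then 0 else if i ∈ A then -b else a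
  have hx0 : ∑ i ∈ F, c i * x i = 0 := by
    have hx : ∀ C : Finset ι, ∀ t : ℝ, (∀ i ∈ C \ S, x i = t) →
        ∑ i ∈ C, c i * x i = (∑ i ∈ C \ S, c i) * t := by
      intro C t ht
      rw [Finset.sum_mul, ← Finset.sum_subset (Finset.sdiff_subset (s := C) (t := S))
        fun i hi hiS => ?_]
      · exact Finset.sum_congr rfl fun i hi => by rw [ht i hi]
      · have : i ∈ S := by
          by_contra h
          exact hiS (Finset.mem_sdiff.2 ⟨hi, h⟩)
        simp [x, this]
    rw [← hABF, Finset.sum_union hdisj, hx A (-b) fun i hi => ?_, hx B a fun i hi => ?_]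
    · ring
    · obtain ⟨hiB, hiS⟩ := Finset.mem_sdiff.1 hi
      simp [x, hiS, Finset.disjoint_right.1 hdisj hiB]
    · obtain ⟨hiA, hiS⟩ := Finset.mem_sdiff.1 hi
      simp [x, hiS, hiA]
  obtain ⟨j, hj⟩ := hAS
  obtain ⟨hjA, hjS⟩ := Finset.mem_sdiff.1 hj
  have hjF := hAF hjA
  obtain ⟨χ, hχ⟩ := exists_dual_apply_eq_of_linearIndepOn (hp.linearIndepOn
    (S := F.erase j) (by rw [Finset.card_erase_of_mem hjF]; omega)) x
  have hχj : χ (p j) = x j := by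
    have h1 : ∑ i ∈ F, c i * χ (p i) = 0 := by
      have := congrArg χ hf
      simp only [map_sum, map_smul, smul_eq_mul, map_zero] at this
      rw [← this]
      exact Finset.sum_congr rfl fun i hi => by simp [c, hi]
    rw [← Finset.add_sum_erase _ _ hjF] at h1 hx0
    rw [Finset.sum_congr rfl fun i hi => by rw [hχ i hi]] at h1
    exact mul_left_cancel₀ ((hAc j).1 hjA).ne' (by linarith)
  have hχF : ∀ i ∈ F, χ (p i) = x i := fun i hi => by
    by_cases hij : i = j
    · rw [hij, hχj]
    · exact hχ i (Finset.mem_erase.2 ⟨hij, hi⟩)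
  refine hF.1.of_face hSF χ (fun i hi => ?_) fun i hi hiS => ?_
  · rw [hχF i (hSF hi)]
    simp [x, hi]
  · rw [hχF i hi]
    simp only [x, if_neg hiS]
    split_ifs <;> linarith

omit [FiniteDimensional ℝ E] in
/-- The triangles of a facet with at most six elements. -/
lemma IsNeighborlyConfig.six_mul_choose_le {p : ι → E} (hp : IsNeighborlyConfig p)
    (hE : Module.finrank ℝ E = 6) {F : Finset ι} (hF : IsFacetSet p F) (hF6 : F.card ≤ 6) :
    ∑ _e ∈ Finset.powersetCard 2 F, 6 ≤
      ∑ e ∈ Finset.powersetCard 2 F, ((linkVertices p e).filter (· ∈ F)).card + 36 := by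
  have hF5 : 5 ≤ F.card := by
    have h1 := hF.2
    have h2 := finrank_range_le_card (R := ℝ) fun i : F => p i
    have h3 : p '' (F : Set ι) = Set.range fun i : F => p i := Set.image_eq_range p F
    rw [Set.finrank, Fintype.card_coe, ← h3] at h2
    omega
  rw [Finset.sum_const, Finset.card_powersetCard, smul_eq_mul]
  rcases Nat.lt_or_ge F.card 6 with h6 | h6
  · have h5 : F.card = 5 := by omega
    have hlocal : ∀ e ∈ Finset.powersetCard 2 F,
        3 ≤ ((linkVertices p e).filter (· ∈ F)).card := by
      intro e he
      obtain ⟨heF, he⟩ := Finset.mem_powersetCard.1 he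
      have h1 : F \ e ⊆ (linkVertices p e).filter (· ∈ F) := by
        intro w hw
        obtain ⟨hwF, hwe⟩ := Finset.mem_sdiff.1 hw
        exact Finset.mem_filter.2 ⟨mem_linkVertices.2 ⟨hwe, hF.1.of_linearIndepOn
          (hp.linearIndepOn h5.le) (Finset.insert_subset hwF heF)⟩, hwF⟩
      have h2 := Finset.card_le_card h1
      rw [Finset.card_sdiff_of_subset heF] at h2
      omega
    have hsum := Finset.sum_le_sum hlocal
    rw [Finset.sum_const, Finset.card_powersetCard, h5, smul_eq_mul] at hsum
    rw [h5]
    norm_num [Nat.choose_two_right] at hsum ⊢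
    omega
  · have h6 : F.card = 6 := by omega
    obtain ⟨A, B, hA, hB, hAF, hBF, hface⟩ := hp.exists_missing_triangles hE hF h6
    have hcompletion : ∀ C e : Finset ι, ((F \ e).filter fun w => insert w e = C).card ≤
        if e ⊆ C then 1 else 0 := by
      intro C e
      split_ifs with heC
      · refine Finset.card_le_one.2 fun v hv w hw => ?_
        simp only [Finset.mem_filter, Finset.mem_sdiff] at hv hw
        have h1 : v ∈ insert w e := hw.2 ▸ hv.2 ▸ Finset.mem_insert_self v e
        exact (Finset.mem_insert.1 h1).resolve_right hv.1.2
      · rw [Nat.le_zero, Finset.card_eq_zero, Finset.filter_eq_empty_iff]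
        rintro w - rfl
        exact heC (Finset.subset_insert w e)
    have hcount : ∀ C ⊆ F, C.card = 3 →
        ∑ e ∈ Finset.powersetCard 2 F, (if e ⊆ C then 1 else 0) = 3 := by
      intro C hCF hC
      rw [← Finset.card_filter]
      have : (Finset.powersetCard 2 F).filter (· ⊆ C) = Finset.powersetCard 2 C := by
        ext e
        simp only [Finset.mem_filter, Finset.mem_powersetCard]
        exact ⟨fun h => ⟨h.2, h.1.2⟩, fun h => ⟨⟨h.1.trans hCF, h.2⟩, h.1⟩⟩
      rw [this, Finset.card_powersetCard, hC]
      rfl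
    have hlocal : ∀ e ∈ Finset.powersetCard 2 F,
        4 ≤ ((linkVertices p e).filter (· ∈ F)).card +
          ((if e ⊆ A then 1 else 0) + (if e ⊆ B then 1 else 0)) := by
      intro e he
      obtain ⟨heF, he⟩ := Finset.mem_powersetCard.1 he
      have h1 : F \ e ⊆ (linkVertices p e).filter (· ∈ F) ∪
          (((F \ e).filter fun w => insert w e = A) ∪
            ((F \ e).filter fun w => insert w e = B)) := by
        intro w hw
        obtain ⟨hwF, hwe⟩ := Finset.mem_sdiff.1 hw
        by_cases hwA : insert w e = A
        · simp [hwF, hwe, hwA]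
        by_cases hwB : insert w e = B
        · simp [hwF, hwe, hwB]
        refine Finset.mem_union_left _ (Finset.mem_filter.2 ⟨mem_linkVertices.2 ⟨hwe, ?_⟩, hwF⟩)
        exact hface _ (Finset.insert_subset hwF heF)
          (by rw [Finset.card_insert_of_notMem hwe, he]) hwA hwB
      have h2 := Finset.card_le_card h1
      rw [Finset.card_sdiff_of_subset heF] at h2
      have h3 := Finset.card_union_le ((linkVertices p e).filter (· ∈ F))
        (((F \ e).filter fun w => insert w e = A) ∪ ((F \ e).filter fun w => insert w e = B))
      have h4 := Finset.card_union_le ((F \ e).filter fun w => insert w e = A)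
        ((F \ e).filter fun w => insert w e = B)
      have h5 := hcompletion A e
      have h6 := hcompletion B e
      omega
    have hsum := Finset.sum_le_sum hlocal
    rw [Finset.sum_add_distrib, Finset.sum_add_distrib, hcount A hAF hA, hcount B hBF hB,
      Finset.sum_const, Finset.card_powersetCard, h6, smul_eq_mul] at hsum
    rw [h6]
    norm_num [Nat.choose_two_right] at hsum ⊢
    omega

/-- A 2-neighborly configuration of rank six with at least ten vectors has at least fifteen
facets. -/
theorem IsNeighborlyConfig.fifteen_le_card_configFacets {p : ι → E} (hp : IsNeighborlyConfig p)
    (hspan : Submodule.span ℝ (Set.range p) = ⊤) (hE : Module.finrank ℝ E = 6)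
    (hι : 10 ≤ Fintype.card ι) : 15 ≤ (configFacets p).card := by
  by_cases hbig : ∃ F, IsFacetSet p F ∧ 7 ≤ F.card
  · obtain ⟨F, hF, hF7⟩ := hbig
    exact hp.fifteen_le_card_of_seven_le hspan hE hF hF7
  push Not at hbig
  have hedges := Finset.sum_le_sum fun e (he : e ∈ Finset.powersetCard 2 Finset.univ) =>
    hp.sum_card_link_add_le hspan hE (by omega) (Finset.mem_powersetCard.1 he).2
  have hfacets := Finset.sum_le_sum fun F (hF : F ∈ configFacets p) =>
    hp.six_mul_choose_le hE (mem_configFacets.1 hF)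
      (by have := hbig F (mem_configFacets.1 hF); omega)
  have swap : ∀ f : Finset ι → Finset ι → ℕ,
      ∑ e ∈ Finset.powersetCard 2 Finset.univ, ∑ F ∈ (configFacets p).filter (e ⊆ ·), f e F =
        ∑ F ∈ configFacets p, ∑ e ∈ Finset.powersetCard 2 F, f e F := fun f =>
    Finset.sum_comm' fun e F => by
      simp only [Finset.mem_powersetCard, Finset.mem_filter, Finset.subset_univ, true_and]
      tauto
  simp only [Finset.card_eq_sum_ones ((configFacets p).filter _), Finset.mul_sum,
    Finset.sum_add_distrib, mul_one] at hedges
  rw [swap, swap] at hedges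
  rw [Finset.sum_add_distrib, Finset.sum_const (36 : ℕ)] at hfacets
  rw [Finset.sum_const (12 : ℕ), Finset.card_powersetCard, Finset.card_univ] at hedges
  have hchoose : 45 ≤ (Fintype.card ι).choose 2 := Nat.choose_le_choose 2 hι
  simp only [smul_eq_mul] at hedges hfacets
  omega

end Configuration

/-- The points of the convex hull of a finite set where a functional attains an upper bound. -/
lemma convexHull_inter_eq_of_le {W : Type*} [AddCommGroup W] [Module ℝ W] {V : Set W}
    (hV : V.Finite) (l : Module.Dual ℝ W) {c : ℝ} (hc : ∀ v ∈ V, l v ≤ c) :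
    {z ∈ convexHull ℝ V | l z = c} = convexHull ℝ {v ∈ V | l v = c} := by
  apply subset_antisymm
  · rintro z ⟨hz, hlz⟩
    lift V to Finset W using hV
    obtain ⟨w, hw0, hw1, hwz⟩ := Finset.mem_convexHull'.1 hz
    have hsum : ∑ v ∈ V, w v * (c - l v) = 0 := by
      have h1 : ∑ v ∈ V, w v * l v = c := by
        rw [← hlz, ← hwz, map_sum]
        simp
      simp only [mul_sub, Finset.sum_sub_distrib, ← Finset.sum_mul, hw1, h1, one_mul, sub_self]
    have hzero := (Finset.sum_eq_zero_iff_of_nonneg fun v hv =>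
      mul_nonneg (hw0 v hv) (sub_nonneg.2 (hc v hv))).1 hsum
    have hw : ∀ v ∈ V, l v ≠ c → w v = 0 := fun v hv hlv =>
      (mul_eq_zero.1 (hzero v hv)).resolve_right (sub_ne_zero.2 hlv.symm)
    have hcoe : {v ∈ (V : Set W) | l v = c} = ((V.filter fun v => l v = c : Finset W) : Set W) := by
      ext v
      simp
    rw [hcoe, Finset.mem_convexHull']
    refine ⟨w, fun v hv => hw0 v (Finset.mem_filter.1 hv).1, ?_, ?_⟩
    · rw [← hw1]
      refine Finset.sum_subset (Finset.filter_subset _ _) fun v hv hv' => hw v hv fun h => hv' ?_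
      exact Finset.mem_filter.2 ⟨hv, h⟩
    · rw [← hwz]
      refine Finset.sum_subset (Finset.filter_subset _ _) fun v hv hv' => ?_
      rw [hw v hv fun h => hv' (Finset.mem_filter.2 ⟨hv, h⟩), zero_smul]
  · refine convexHull_min (fun v hv => ⟨subset_convexHull ℝ V hv.1, hv.2⟩) ?_
    exact (convex_convexHull ℝ V).inter (convex_hyperplane l.isLinear c)

lemma isExposed_convexHull_sep {N : ℕ} {V : Set (Fin N → ℝ)} (hV : V.Finite)
    (l : Module.Dual ℝ (Fin N → ℝ)) {c : ℝ} (hc : ∀ v ∈ V, l v ≤ c) :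
    IsExposed ℝ (convexHull ℝ V) (convexHull ℝ {v ∈ V | l v = c}) := by
  rw [← convexHull_inter_eq_of_le hV l hc]
  rintro ⟨x, hx, hlx⟩
  have hle : ∀ y ∈ convexHull ℝ V, l y ≤ c :=
    fun y hy => convexHull_min (t := {y | l y ≤ c}) hc (convex_halfSpace_le l.isLinear c) hy
  refine ⟨LinearMap.toContinuousLinearMap l, ?_⟩
  ext z
  simp only [Set.mem_ofPred_eq, LinearMap.coe_toContinuousLinearMap']
  refine and_congr_right fun hz => ⟨fun h y hy => h ▸ hle y hy, fun h => ?_⟩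
  exact le_antisymm (hle z hz) (hlx ▸ h x hx)

/-- A nonempty exposed face is the set of points where a functional attains its maximum. -/
lemma IsExposed.exists_eq_sep {N : ℕ} {P F : Set (Fin N → ℝ)} (hF : IsExposed ℝ P F)
    (hne : F.Nonempty) : ∃ (l : Module.Dual ℝ (Fin N → ℝ)) (c : ℝ), (∀ y ∈ P, l y ≤ c) ∧
      F = {x ∈ P | l x = c} := by
  obtain ⟨l, rfl⟩ := hF hne
  obtain ⟨x, hx, hlx⟩ := hne
  refine ⟨l, l x, hlx, ?_⟩
  ext z
  refine and_congr_right fun hz => ⟨fun h => le_antisymm (hlx z hz) (h x hx), fun h y hy => ?_⟩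
  exact (hlx y hy).trans h.ge

lemma IsVertex.mem_extremePoints {N : ℕ} {P : Set (Fin N → ℝ)} {v : Fin N → ℝ}
    (hv : IsVertex P v) : v ∈ P.extremePoints ℝ :=
  isExtreme_singleton.1 (IsExposed.isExtreme hv)

lemma IsVertex.mem_of_mem_convexHull {N : ℕ} {P T : Set (Fin N → ℝ)} {v : Fin N → ℝ}
    (hv : IsVertex P v) (hT : convexHull ℝ T ⊆ P) (hvT : v ∈ convexHull ℝ T) : v ∈ T :=
  extremePoints_convexHull_subset
    (inter_extremePoints_subset_extremePoints_of_subset hT ⟨hvT, hv.mem_extremePoints⟩)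

/-- The vertices of a polytope are its extreme points. -/
lemma vertexSet_convexHull_eq_extremePoints {N : ℕ} {S : Set (Fin N → ℝ)} (hS : S.Finite) :
    vertexSet (convexHull ℝ S) = (convexHull ℝ S).extremePoints ℝ := by
  refine subset_antisymm (fun v hv => IsVertex.mem_extremePoints hv) fun x hx => ?_
  have hxS : x ∈ S := extremePoints_convexHull_subset hx
  have hx' : x ∉ convexHull ℝ (S \ {x}) := fun h =>
    (((convex_convexHull ℝ S).mem_extremePoints_iff_mem_sdiff_convexHull_sdiff.1 hx).2
      (convexHull_mono (Set.sdiff_subset_sdiff_left (subset_convexHull ℝ S)) h))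
  obtain ⟨f, u, hfx, hfu⟩ := geometric_hahn_banach_point_closed (convex_convexHull ℝ (S \ {x}))
    ((hS.subset Set.sdiff_subset).isClosed_convexHull ℝ) hx'
  have hlt : ∀ v ∈ S, v ≠ x → f x < f v := fun v hv hvx =>
    hfx.trans (hfu v (subset_convexHull ℝ _ ⟨hv, hvx⟩))
  have hexp := isExposed_convexHull_sep hS (-f.toLinearMap) (c := -f x) fun v hv => by
    by_cases h : v = x
    · simp [h]
    · simpa using (hlt v hv h).le
  have hsep : {v ∈ S | (-f.toLinearMap) v = -f x} = {x} := by
    ext v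
    refine ⟨fun ⟨hv, h⟩ => ?_, fun h => ?_⟩
    · by_contra hvx
      have : f v = f x := by simpa using h
      exact (hlt v hv hvx).ne' this
    · rw [Set.mem_singleton_iff.1 h]
      exact ⟨hxS, by simp⟩
  rw [hsep, convexHull_singleton] at hexp
  exact hexp

lemma IsPolytope.finite_vertexSet {N : ℕ} {P : Set (Fin N → ℝ)} (hP : IsPolytope P) :
    (vertexSet P).Finite := by
  obtain ⟨S, rfl⟩ := hP
  rw [vertexSet_convexHull_eq_extremePoints S.finite_toSet]
  exact S.finite_toSet.subset extremePoints_convexHull_subset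

/-- A polytope is the convex hull of its vertices. -/
lemma IsPolytope.convexHull_vertexSet {N : ℕ} {P : Set (Fin N → ℝ)} (hP : IsPolytope P) :
    convexHull ℝ (vertexSet P) = P := by
  have hfin := hP.finite_vertexSet
  obtain ⟨S, rfl⟩ := hP
  have h := closure_convexHull_extremePoints (S.finite_toSet.isCompact_convexHull ℝ)
    (convex_convexHull ℝ (S : Set (Fin N → ℝ)))
  rw [← vertexSet_convexHull_eq_extremePoints S.finite_toSet,
    (hfin.isClosed_convexHull ℝ).closure_eq] at h
  exact h

/-- A polytope has finitely many facets. -/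
lemma IsPolytope.finite_facetSet {N : ℕ} {P : Set (Fin N → ℝ)} (hP : IsPolytope P) :
    (facetSet P).Finite := by
  refine (hP.finite_vertexSet.finite_subsets.image (convexHull ℝ)).subset ?_
  rintro F ⟨hF, hne, -⟩
  obtain ⟨l, c, hc, rfl⟩ := hF.exists_eq_sep hne
  refine ⟨{v ∈ vertexSet P | l v = c}, Set.sep_subset _ _, ?_⟩
  rw [← convexHull_inter_eq_of_le hP.finite_vertexSet l fun v hv => hc v ?_,
    hP.convexHull_vertexSet]
  exact hP.convexHull_vertexSet ▸ subset_convexHull ℝ _ hv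

/-- Homogenization raises the dimension by one. -/
lemma finrank_span_homogenize {N : ℕ} {T : Set (Fin N → ℝ)} (hT : T.Nonempty) :
    Module.finrank ℝ (Submodule.span ℝ ((fun v => ((1 : ℝ), v)) '' T)) =
      pdim (convexHull ℝ T) + 1 := by
  obtain ⟨v₀, hv₀⟩ := hT
  let Φ : ℝ × vectorSpan ℝ T →ₗ[ℝ] ℝ × (Fin N → ℝ) :=
    (LinearMap.fst ℝ ℝ _).prod ((LinearMap.toSpanSingleton ℝ _ v₀).coprod
      (vectorSpan ℝ T).subtype)
  have hΦ : ∀ t d, Φ (t, d) = (t, t • v₀ + d) := fun t d => by simp [Φ]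
  have hinj : Function.Injective Φ := by
    rintro ⟨t, d⟩ ⟨t', d'⟩ h
    rw [hΦ, hΦ, Prod.mk.injEq] at h
    obtain ⟨rfl, h⟩ := h
    simpa using h
  have hrange : LinearMap.range Φ = Submodule.span ℝ ((fun v => ((1 : ℝ), v)) '' T) := by
    apply le_antisymm
    · rintro _ ⟨⟨t, d, hd⟩, rfl⟩
      have hdmem : ((0 : ℝ), d) ∈ Submodule.span ℝ ((fun v => ((1 : ℝ), v)) '' T) := by
        have hle : vectorSpan ℝ T ≤ (Submodule.span ℝ ((fun v => ((1 : ℝ), v)) '' T)).comap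
            (LinearMap.inr ℝ ℝ (Fin N → ℝ)) := by
          rw [vectorSpan_def, Submodule.span_le]
          rintro _ ⟨a, ha, b, hb, rfl⟩
          have := Submodule.sub_mem _
            (Submodule.subset_span (R := ℝ) (Set.mem_image_of_mem (fun v => ((1 : ℝ), v)) ha))
            (Submodule.subset_span (R := ℝ) (Set.mem_image_of_mem (fun v => ((1 : ℝ), v)) hb))
          simpa using this
        exact hle hd
      have := Submodule.add_mem _ (Submodule.smul_mem _ t
        (Submodule.subset_span (R := ℝ) (Set.mem_image_of_mem (fun v => ((1 : ℝ), v)) hv₀))) hdmem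
      rw [hΦ]
      simpa using this
    · rw [Submodule.span_le]
      rintro _ ⟨v, hv, rfl⟩
      refine ⟨(1, ⟨v - v₀, vsub_mem_vectorSpan ℝ hv hv₀⟩), ?_⟩
      rw [hΦ]
      simp
  rw [← hrange, LinearMap.finrank_range_of_inj hinj, Module.finrank_prod, Module.finrank_self,
    pdim, affineSpan_convexHull, direction_affineSpan, add_comm]

/-- The linear span of the homogenized vertices of `P`. -/
def homogenizedSpan {N : ℕ} (P : Set (Fin N → ℝ)) : Submodule ℝ (ℝ × (Fin N → ℝ)) :=
  Submodule.span ℝ ((fun v => ((1 : ℝ), v)) '' vertexSet P)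

/-- The configuration of homogenized vertices of `P`. -/
def homogenizedVertex {N : ℕ} (P : Set (Fin N → ℝ)) (v : vertexSet P) : homogenizedSpan P :=
  ⟨(1, v), Submodule.subset_span ⟨v, v.2, rfl⟩⟩

lemma span_range_homogenizedVertex {N : ℕ} (P : Set (Fin N → ℝ)) :
    Submodule.span ℝ (Set.range (homogenizedVertex P)) = ⊤ :=
  span_range_codRestrict_eq_top _ (congrArg (Submodule.span ℝ) (Set.image_eq_range _ _).symm)

lemma finrank_homogenizedSpan {N : ℕ} {P : Set (Fin N → ℝ)} (hP : IsPolytope P)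
    (hne : (vertexSet P).Nonempty) : Module.finrank ℝ (homogenizedSpan P) = pdim P + 1 := by
  rw [homogenizedSpan, finrank_span_homogenize hne, hP.convexHull_vertexSet]

lemma finrank_span_homogenizedVertex_image {N : ℕ} {P : Set (Fin N → ℝ)} {S : Set (vertexSet P)}
    (hS : S.Nonempty) :
    Module.finrank ℝ (Submodule.span ℝ (homogenizedVertex P '' S)) =
      pdim (convexHull ℝ (Subtype.val '' S)) + 1 := by
  rw [← finrank_span_homogenize (hS.image _), ← Submodule.finrank_map_subtype_eq,
    Submodule.map_span, ← Set.image_comp, ← Set.image_comp]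
  rfl

lemma IsExposed.isFaceSet_homogenizedVertex {N : ℕ} {P F : Set (Fin N → ℝ)}
    (hP : IsPolytope P) (hF : IsExposed ℝ P F) (hne : F.Nonempty) {S : Finset (vertexSet P)}
    (hS : ∀ v, v ∈ S ↔ (v : Fin N → ℝ) ∈ F) : IsFaceSet (homogenizedVertex P) S := by
  obtain ⟨l, c, hc, rfl⟩ := hF.exists_eq_sep hne
  have hmem : ∀ v : vertexSet P, (v : Fin N → ℝ) ∈ P := fun v =>
    hP.convexHull_vertexSet.subset (subset_convexHull ℝ _ v.2)
  let φ : Module.Dual ℝ (ℝ × (Fin N → ℝ)) :=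
    c • LinearMap.fst ℝ ℝ (Fin N → ℝ) - l ∘ₗ LinearMap.snd ℝ ℝ (Fin N → ℝ)
  have hφ : ∀ v, φ.domRestrict (homogenizedSpan P) (homogenizedVertex P v) = c - l v := fun v => by
    simp [φ, homogenizedVertex]
  refine ⟨φ.domRestrict (homogenizedSpan P), fun v => ?_, fun v => ?_⟩
  · rw [hφ]
    exact sub_nonneg.2 (hc v (hmem v))
  · rw [hφ, hS, sub_eq_zero]
    exact ⟨fun h => ⟨hmem v, h.symm⟩, fun h => h.2.symm⟩

lemma TwoNeighborly.isNeighborlyConfig {N : ℕ} {P : Set (Fin N → ℝ)} (hP : IsPolytope P)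
    (hnb : TwoNeighborly P) : IsNeighborlyConfig (homogenizedVertex P) := by
  classical
  intro S hS
  obtain h0 | h1 | h2 : S.card = 0 ∨ S.card = 1 ∨ S.card = 2 := by omega
  · rw [Finset.card_eq_zero] at h0
    subst h0
    refine ⟨(LinearMap.fst ℝ ℝ (Fin N → ℝ)).domRestrict (homogenizedSpan P), fun v => ?_,
      fun v => ?_⟩ <;> simp [homogenizedVertex]
  · obtain ⟨v, rfl⟩ := Finset.card_eq_one.1 h1
    refine IsExposed.isFaceSet_homogenizedVertex hP (F := {(v : Fin N → ℝ)}) v.2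
      (Set.singleton_nonempty _) fun w => ?_
    simp [Subtype.ext_iff]
  · obtain ⟨u, v, huv, rfl⟩ := Finset.card_eq_two.1 h2
    have hexp := (hnb u v u.2 v.2 (Subtype.coe_injective.ne huv)).1
    refine hexp.isFaceSet_homogenizedVertex hP
      ⟨u, subset_convexHull ℝ _ (Set.mem_insert _ _)⟩ fun w => ?_
    have hw : w ∈ ({u, v} : Finset (vertexSet P)) ↔
        (w : Fin N → ℝ) ∈ ({(u : Fin N → ℝ), (v : Fin N → ℝ)} : Set (Fin N → ℝ)) := by
      simp [Subtype.ext_iff]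
    rw [hw]
    exact ⟨fun h => subset_convexHull ℝ _ h,
      fun h => IsVertex.mem_of_mem_convexHull w.2 hexp.subset h⟩

lemma IsFaceSet.isExposed_convexHull {N : ℕ} {P : Set (Fin N → ℝ)} (hP : IsPolytope P)
    {S : Finset (vertexSet P)} (hS : IsFaceSet (homogenizedVertex P) S) :
    IsExposed ℝ P (convexHull ℝ (Subtype.val '' (S : Set (vertexSet P)))) := by
  obtain ⟨φ, hφ, hφS⟩ := hS
  obtain ⟨χ, hχ⟩ := LinearMap.exists_extend φ
  have hval : ∀ v : vertexSet P, φ (homogenizedVertex P v) = χ (1, 0) + χ (0, v) := fun v => by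
    rw [← map_add, ← hχ]
    simp [homogenizedVertex]
  have hexp := isExposed_convexHull_sep hP.finite_vertexSet
    (-(χ ∘ₗ LinearMap.inr ℝ ℝ (Fin N → ℝ))) (c := χ (1, 0)) fun v hv => by
      have := hφ ⟨v, hv⟩
      rw [hval] at this
      simpa using neg_le_iff_add_nonneg.2 this
  have hsep : {v ∈ vertexSet P | (-(χ ∘ₗ LinearMap.inr ℝ ℝ (Fin N → ℝ))) v = χ (1, 0)} =
      Subtype.val '' (S : Set (vertexSet P)) := by
    ext v
    simp only [Set.mem_sep_iff, Set.mem_image, Finset.mem_coe, Subtype.exists, exists_and_right,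
      exists_eq_right]
    rw [← exists_prop]
    refine exists_congr fun hv => ?_
    rw [← hφS, hval]
    simp only [LinearMap.neg_apply, LinearMap.comp_apply, LinearMap.inr_apply]
    constructor <;> intro h <;> linarith
  rwa [hsep, hP.convexHull_vertexSet] at hexp

/-- Every 2-neighborly 5-polytope with at least 10 vertices has at least
15 facets. -/
theorem two_neighborly_five_polytope_bound
    {N : ℕ} (P : Set (Fin N → ℝ))
    (hP : IsPolytope P) (hdim : pdim P = 5) (hnb : TwoNeighborly P)
    (hv : 10 ≤ (vertexSet P).ncard) :
    15 ≤ (facetSet P).ncard := by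
  have hfin := hP.finite_vertexSet
  have hne : (vertexSet P).Nonempty := by
    rw [← Set.ncard_pos hfin]
    omega
  have hE := finrank_homogenizedSpan hP hne
  rw [hdim] at hE
  have := hfin.fintype
  classical
  have hcard : 10 ≤ Fintype.card (vertexSet P) := by
    rwa [← Nat.card_eq_fintype_card]
  have hbound := (hnb.isNeighborlyConfig hP).fifteen_le_card_configFacets
    (span_range_homogenizedVertex P) hE hcard
  rw [← Set.ncard_coe_finset] at hbound
  refine hbound.trans (Set.ncard_le_ncard_of_injOn
    (fun S => convexHull ℝ (Subtype.val '' (S : Set (vertexSet P)))) (fun S hS => ?_)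
    (fun S hS S' hS' hSS' => ?_) hP.finite_facetSet)
  · have hS := mem_configFacets.1 hS
    have hSne : (S : Set (vertexSet P)).Nonempty := by
      by_contra h
      have := hS.2
      rw [Set.not_nonempty_iff_eq_empty.1 h, hE, Set.image_empty, Submodule.span_empty,
        finrank_bot] at this
      omega
    have hrank := hS.2
    rw [finrank_span_homogenizedVertex_image hSne, hE] at hrank
    exact ⟨hS.1.isExposed_convexHull hP, (hSne.image _).convexHull, by omega⟩
  · have hmem : ∀ T ∈ (configFacets (homogenizedVertex P) : Set (Finset (vertexSet P))),
        ∀ v : vertexSet P, v ∈ T ↔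
          (v : Fin N → ℝ) ∈ convexHull ℝ (Subtype.val '' (T : Set (vertexSet P))) := by
      intro T hT v
      refine ⟨fun h => subset_convexHull ℝ _ ⟨v, h, rfl⟩, fun h => ?_⟩
      have hsub := ((mem_configFacets.1 hT).1.isExposed_convexHull hP).subset
      obtain ⟨w, hw, hwv⟩ := IsVertex.mem_of_mem_convexHull v.2 hsub h
      exact Subtype.coe_injective hwv ▸ hw
    ext v
    rw [hmem S hS, hmem S' hS']
    exact Set.ext_iff.1 hSS' v
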